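/- arXiv:2212.14292 — 14 statements merged into one kernel-verified Lean document; each statement's English description precedes it below -/
import Mathlib

section
/- Let G be a group, K a subgroup of G of index 2, s an element of G not in K, and D ≥ 0. Let β : K → ℝ satisfy: |β(k₁k₂) − β(k₁) − β(k₂)| ≤ D for all k₁, k₂ ∈ K; β(s k s⁻¹) = −β(k) for all k ∈ K; and β(s²) = 0. Define ε : G → ℝ by ε(g) = 1 if g ∈ K and ε(g) = −1 otherwise, and define φ : G → ℝ by φ(g) = β(g) if g ∈ K and φ(g) = β(g s⁻¹) if g ∉ K. Then |φ(g₁g₂) − φ(g₁) − ε(g₁)·φ(g₂)| ≤ 2D for all g₁, g₂ ∈ G. -/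
/-- The Busemann quasimorphism on an index-2 subgroup `K` extends to an
`ε`-quasicocycle on `G` of defect at most `2 * D`. -/
theorem busemann_quasicocycle_extension {G : Type*} [Group G] (K : Subgroup G)
    (hK : K.index = 2) (s : G) (hs : s ∉ K) (D : ℝ) (hD : 0 ≤ D)
    (β : G → ℝ)
    (hβq : ∀ k₁ ∈ K, ∀ k₂ ∈ K, |β (k₁ * k₂) - β k₁ - β k₂| ≤ D)
    (hβconj : ∀ k ∈ K, β (s * k * s⁻¹) = -β k)
    (hβs2 : β (s ^ 2) = 0)
    (ε φ : G → ℝ)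
    (hε₁ : ∀ g ∈ K, ε g = 1) (hε₂ : ∀ g : G, g ∉ K → ε g = -1)
    (hφ₁ : ∀ g ∈ K, φ g = β g) (hφ₂ : ∀ g : G, g ∉ K → φ g = β (g * s⁻¹)) :
    ∀ g₁ g₂ : G, |φ (g₁ * g₂) - φ g₁ - ε g₁ * φ g₂| ≤ 2 * D := by
  intro g₁ g₂
  have hm : ∀ {a b : G}, a * b ∈ K ↔ (a ∈ K ↔ b ∈ K) := Subgroup.mul_mem_iff_of_index_two hK
  have hsi : s⁻¹ ∉ K := fun h => hs (by simpa using K.inv_mem h)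
  have hcm : ∀ k ∈ K, s * k * s⁻¹ ∈ K := fun k hk => by
    rw [hm, hm]; tauto
  have hs2 : s ^ 2 ∈ K := by rw [pow_two, hm]
  by_cases h1 : g₁ ∈ K <;> by_cases h2 : g₂ ∈ K
  · have h12 : g₁ * g₂ ∈ K := K.mul_mem h1 h2
    rw [hφ₁ _ h12, hφ₁ _ h1, hφ₁ _ h2, hε₁ _ h1, one_mul]
    linarith [hβq _ h1 _ h2]
  · have h12 : g₁ * g₂ ∉ K := by rw [hm]; tauto
    have h3 : g₂ * s⁻¹ ∈ K := by rw [hm]; tauto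
    rw [hφ₂ _ h12, hφ₁ _ h1, hφ₂ _ h2, hε₁ _ h1, one_mul, mul_assoc]
    linarith [hβq _ h1 _ h3]
  · have h12 : g₁ * g₂ ∉ K := by rw [hm]; tauto
    have h3 : g₁ * s⁻¹ ∈ K := by rw [hm]; tauto
    have e : g₁ * g₂ * s⁻¹ = (g₁ * s⁻¹) * (s * g₂ * s⁻¹) := by group
    have h := hβq _ h3 _ (hcm _ h2)
    rw [hφ₂ _ h12, hφ₂ _ h1, hφ₁ _ h2, hε₂ _ h1, e]
    rw [hβconj _ h2] at h
    rw [neg_one_mul]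
    linarith
  · have h12 : g₁ * g₂ ∈ K := by rw [hm]; tauto
    have h3 : g₁ * s⁻¹ ∈ K := by rw [hm]; tauto
    have h4 : g₂ * s⁻¹ ∈ K := by rw [hm]; tauto
    have e : g₁ * g₂ = (g₁ * s⁻¹) * (s * (g₂ * s⁻¹) * s⁻¹) * s ^ 2 := by
      rw [pow_two]; group
    have ha := hβq _ h3 _ (hcm _ h4)
    have hb := hβq _ (K.mul_mem h3 (hcm _ h4)) _ hs2
    rw [hβs2, ← e] at hb
    rw [hβconj _ h4] at ha
    rw [hφ₁ _ h12, hφ₂ _ h1, hφ₂ _ h2, hε₂ _ h1]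
    rw [abs_le] at *
    constructor <;> linarith [ha.1, ha.2, hb.1, hb.2]
end

section
/- Let G be a group and ε : G → {±1} a surjective multiplicative homomorphism with kernel K. Let φ : G → ℝ be an unbounded ε-quasicocycle whose restriction to K is homogeneous, i.e. φ(kⁿ) = n·φ(k) for all k ∈ K and n ∈ ℤ. Let C > 0 be such that |φ(gh) − φ(g) − ε(g)·φ(h)| ≤ C/2 for all g, h ∈ G, there exists k ∈ K with 0 < φ(k) < C/2, and there exists s ∈ G∖K with 0 ≤ φ(s) < C/2. Let X := {g ∈ G : |φ(g)| < C}. Then X generates G, and there exist constants A ≥ 1 and B ≥ 0 such that: (i) whenever g ∈ G is a product of n elements of X ∪ X⁻¹, one has |φ(g)| ≤ A·n + B; (ii) every g ∈ G can be written as a product of at most A·|φ(g)| + B elements of X ∪ X⁻¹; (iii) for every t ∈ ℝ there exists g ∈ G with |φ(g) − t| ≤ A. (In other words, φ is a quasi-isometry from G with the word metric of X to ℝ.) -/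
/-- An unbounded `ε`-quasicocycle (homogeneous on the kernel of `ε`) gives a
quasi-isometry from `G`, with the word metric of `X := {g : |φ g| < C}`, to `ℝ`. -/
theorem quasicocycle_quasi_isometry {G : Type*} [Group G]
    (ε : G → ℝ) (hεmul : ∀ g h : G, ε (g * h) = ε g * ε h)
    (hεval : ∀ g : G, ε g = 1 ∨ ε g = -1)
    (hεsurj : ∃ g : G, ε g = -1)
    (φ : G → ℝ)
    (hunb : ∀ M : ℝ, ∃ g : G, M < |φ g|)
    (hhom : ∀ k : G, ε k = 1 → ∀ n : ℤ, φ (k ^ n) = n * φ k)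
    (C : ℝ) (hC : 0 < C)
    (hdef : ∀ g h : G, |φ (g * h) - φ g - ε g * φ h| ≤ C / 2)
    (hk : ∃ k : G, ε k = 1 ∧ 0 < φ k ∧ φ k < C / 2)
    (hs : ∃ s : G, ε s = -1 ∧ 0 ≤ φ s ∧ φ s < C / 2) :
    Subgroup.closure {g : G | |φ g| < C} = ⊤ ∧
      ∃ A B : ℝ, 1 ≤ A ∧ 0 ≤ B ∧
        (∀ l : List G, (∀ x ∈ l, |φ x| < C ∨ |φ x⁻¹| < C) →
          |φ l.prod| ≤ A * l.length + B) ∧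
        (∀ g : G, ∃ l : List G, (∀ x ∈ l, |φ x| < C ∨ |φ x⁻¹| < C) ∧ l.prod = g ∧
          (l.length : ℝ) ≤ A * |φ g| + B) ∧
        (∀ t : ℝ, ∃ g : G, |φ g - t| ≤ A) := by
  obtain ⟨k, hk1, hp, hpC⟩ := hk
  have hε1 : ε 1 = 1 := by
    have h := hεmul 1 1
    rw [mul_one] at h
    rcases hεval 1 with h1 | h1
    · exact h1
    · rw [h1] at h; norm_num at h
  have hφ1 : φ 1 = 0 := by
    have h := hhom k hk1 0
    simpa using h
  have hεpow : ∀ n : ℕ, ε (k ^ n) = 1 := by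
    intro n
    induction n with
    | zero => simpa using hε1
    | succ n ih => rw [pow_succ, hεmul, ih, hk1, one_mul]
  have hεinv : ∀ g : G, ε g = 1 → ε g⁻¹ = 1 := by
    intro g hg
    have h := hεmul g g⁻¹
    rw [mul_inv_cancel, hε1, hg, one_mul] at h
    exact h.symm
  have hεz : ∀ n : ℤ, ε (k ^ n) = 1 := by
    intro n
    obtain ⟨m, rfl | rfl⟩ := n.eq_nat_or_neg
    · rw [zpow_natCast]; exact hεpow m
    · rw [zpow_neg, zpow_natCast]; exact hεinv _ (hεpow m)
  have habs : ∀ g h : G, |ε g * φ h| = |φ h| := by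
    intro g h
    rcases hεval g with h1 | h1 <;> rw [h1] <;> simp
  have hX : ∀ x : G, (|φ x| < C ∨ |φ x⁻¹| < C) → |φ x| ≤ 3 * C / 2 := by
    rintro x (h | h)
    · linarith
    · have h1 := hdef x⁻¹ x
      rw [inv_mul_cancel, hφ1] at h1
      rw [← habs x⁻¹ x]
      rw [abs_le] at h1 ⊢
      rw [abs_lt] at h
      constructor <;> linarith [h1.1, h1.2, h.1, h.2]
  have hkX : |φ k| < C := by
    rw [abs_of_pos hp]; linarith
  -- key decomposition
  have key : ∀ g : G, ∃ l : List G, (∀ x ∈ l, |φ x| < C ∨ |φ x⁻¹| < C) ∧ l.prod = g ∧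
      (l.length : ℝ) ≤ |φ g| / φ k + 2 := by
    intro g
    set n : ℤ := ⌊φ g / φ k⌋ with hn
    have hn1 : (n : ℝ) ≤ φ g / φ k := Int.floor_le _
    have hn2 : φ g / φ k < n + 1 := Int.lt_floor_add_one _
    have e1 : (n : ℝ) * φ k ≤ φ g := (le_div_iff₀ hp).1 hn1
    have e2 : φ g < (n + 1) * φ k := (div_lt_iff₀ hp).1 hn2
    have hh : |φ (k ^ (-n) * g)| < C := by
      have h1 := hdef (k ^ (-n)) g
      rw [hεz, hhom k hk1] at h1
      push_cast at h1
      rw [abs_le] at h1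
      rw [abs_lt]
      constructor <;> nlinarith [h1.1, h1.2]
    obtain ⟨y, hy, hyk⟩ : ∃ y : G, (|φ y| < C ∨ |φ y⁻¹| < C) ∧ y ^ n.natAbs = k ^ n := by
      obtain ⟨m, hm | hm⟩ := n.eq_nat_or_neg
      · exact ⟨k, Or.inl hkX, by rw [hm]; simp⟩
      · exact ⟨k⁻¹, Or.inr (by simpa using hkX), by rw [hm]; simp⟩
    refine ⟨List.replicate n.natAbs y ++ [k ^ (-n) * g], ?_, ?_, ?_⟩
    · intro x hx
      rcases List.mem_append.1 hx with hx | hx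
      · rw [List.eq_of_mem_replicate hx]; exact hy
      · rw [List.mem_singleton.1 hx]; exact Or.inl hh
    · rw [List.prod_append, List.prod_replicate, hyk]; simp
    · have h3 : ((n.natAbs : ℕ) : ℝ) = |(n : ℝ)| := by
        rw [Nat.cast_natAbs, Int.cast_abs]
      have h4 : |φ g / φ k| = |φ g| / φ k := by rw [abs_div, abs_of_pos hp]
      have h5 : |(n : ℝ)| ≤ |φ g / φ k| + 1 := by
        rw [abs_le]
        constructor <;> linarith [neg_abs_le (φ g / φ k), le_abs_self (φ g / φ k)]
      rw [List.length_append, List.length_replicate, List.length_singleton]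
      push_cast
      rw [h3]
      linarith
  have hq : 0 < 1 / φ k := by positivity
  refine ⟨?_, 1 + 2 * C + 1 / φ k, 2, by linarith, by norm_num, ?_, ?_, ?_⟩
  · rw [eq_top_iff]
    intro g _
    obtain ⟨l, hl, rfl, -⟩ := key g
    refine Subgroup.list_prod_mem _ ?_
    intro x hx
    rcases hl x hx with h | h
    · exact Subgroup.subset_closure h
    · exact (Subgroup.inv_mem_iff _).1 (Subgroup.subset_closure h)
  · intro l hl
    have h2 : |φ l.prod| ≤ 2 * C * l.length := by
      induction l with
      | nil => simp [hφ1]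
      | cons x l ih =>
        have h1 := ih (fun y hy => hl y (List.mem_cons_of_mem _ hy))
        have h3 := hX x (hl x List.mem_cons_self)
        have h4 := hdef x l.prod
        have h5 := habs x l.prod
        rw [← h5] at h1
        rw [List.prod_cons, List.length_cons]
        push_cast
        rw [abs_le] at h1 h3 h4 ⊢
        constructor <;> linarith [h1.1, h1.2, h3.1, h3.2, h4.1, h4.2]
    have h6 : (0 : ℝ) ≤ l.length := Nat.cast_nonneg _
    nlinarith [mul_nonneg hq.le h6]
  · intro g
    obtain ⟨l, hl, hg, hlen⟩ := key g
    refine ⟨l, hl, hg, hlen.trans ?_⟩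
    have h7 := abs_nonneg (φ g)
    have h8 : |φ g| / φ k = 1 / φ k * |φ g| := by ring
    rw [h8]
    nlinarith [mul_nonneg hC.le h7]
  · intro t
    refine ⟨k ^ ⌊t / φ k⌋, ?_⟩
    rw [hhom k hk1]
    have e1 := (le_div_iff₀ hp).1 (Int.floor_le (t / φ k))
    have e2 := (div_lt_iff₀ hp).1 (Int.lt_floor_add_one (t / φ k))
    rw [abs_le]
    constructor <;> linarith
end

section
/- Let G be an abelian group. Then G has Property (NL) if and only if G is a torsion group, i.e. every element of G has finite order. -/
def IsGeodesicSpace (X : Type*) [MetricSpace X] : Prop :=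
  ∀ x y : X, ∃ γ : ℝ → X, γ 0 = x ∧ γ (dist x y) = y ∧
    ∀ s ∈ Set.Icc (0 : ℝ) (dist x y), ∀ t ∈ Set.Icc (0 : ℝ) (dist x y),
      dist (γ s) (γ t) = |s - t|

def IsGromovHyperbolic (X : Type*) [MetricSpace X] : Prop :=
  ∃ δ : ℝ, 0 ≤ δ ∧ ∀ x y z w : X,
    dist x y + dist z w ≤ max (dist x z + dist y w) (dist x w + dist y z) + 2 * δ

def IsIsometricAction (G : Type*) [Group G] (X : Type*) [MetricSpace X]
    (a : G → X → X) : Prop :=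
  (∀ x, a 1 x = x) ∧ (∀ g h x, a (g * h) x = a g (a h x)) ∧
    (∀ g x y, dist (a g x) (a g y) = dist x y)

def IsLoxodromic (G : Type*) [Group G] (X : Type*) [MetricSpace X]
    (a : G → X → X) (g : G) : Prop :=
  ∃ (x : X) (A B : ℝ), 1 ≤ A ∧ 0 ≤ B ∧ ∀ m n : ℤ,
    |(m : ℝ) - (n : ℝ)| / A - B ≤ dist (a (g ^ m) x) (a (g ^ n) x) ∧
      dist (a (g ^ m) x) (a (g ^ n) x) ≤ A * |(m : ℝ) - (n : ℝ)| + B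

/-- Property (NL): no isometric action on a Gromov hyperbolic geodesic metric
space admits a loxodromic element. -/
def PropertyNL (G : Type*) [Group G] : Prop :=
  ∀ (X : Type) [MetricSpace X], IsGeodesicSpace X → IsGromovHyperbolic X →
    ∀ a : G → X → X, IsIsometricAction G X a → ∀ g : G, ¬ IsLoxodromic G X a g

/-- An abelian group has Property (NL) if and only if it is a torsion group. -/
theorem abelian_propertyNL_iff_torsion (G : Type*) [CommGroup G] :
    PropertyNL G ↔ ∀ g : G, ∃ n : ℕ, 0 < n ∧ g ^ n = 1 := by
  constructor
  · intro h g
    by_contra hg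
    push Not at hg
    have hinj : Function.Injective (zmultiplesHom (Additive G) (Additive.ofMul g)) := by
      rw [injective_iff_map_eq_zero]
      intro n hn
      have hn' : g ^ n = 1 := by
        have := congrArg Additive.toMul hn
        simpa using this
      by_contra hne
      refine hg n.natAbs (Int.natAbs_pos.mpr hne) ?_
      exact pow_natAbs_eq_one.mpr hn'
    have hb : Module.Baer ℤ ℝ := Module.Baer.of_divisible ℝ
    obtain ⟨φ, hφ⟩ := hb.extension_property_addMonoidHom
      (zmultiplesHom (Additive G) (Additive.ofMul g)) hinj (Int.castAddHom ℝ)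
    have hφn : ∀ n : ℤ, φ (Additive.ofMul (g ^ n)) = n := by
      intro n
      have := DFunLike.congr_fun hφ n
      simpa using this
    refine h ℝ ?_ ?_ (fun g x => φ (Additive.ofMul g) + x) ?_ g ?_
    · intro x y
      rcases le_total x y with hxy | hxy
      · refine ⟨fun t => x + t, by simp, ?_, ?_⟩
        · rw [Real.dist_eq, abs_of_nonpos (by linarith)]; ring
        · intro s _ t _
          rw [Real.dist_eq]; congr 1; ring
      · refine ⟨fun t => x - t, by simp, ?_, ?_⟩
        · rw [Real.dist_eq, abs_of_nonneg (by linarith)]; ring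
        · intro s _ t _
          rw [Real.dist_eq, abs_sub_comm s t]; congr 1; ring
    · refine ⟨0, le_rfl, fun x y z w => ?_⟩
      simp only [Real.dist_eq]
      grind
    · refine ⟨fun x => by simp, fun g h x => by simp [add_assoc], fun g x y => by simp⟩
    · refine ⟨0, 1, 0, le_rfl, le_rfl, fun m n => ?_⟩
      simp [hφn, -ofMul_zpow, Real.dist_eq]
  · rintro h X _ - - a ⟨h1, -, -⟩ g ⟨x, A, B, hA, hB, hl⟩
    obtain ⟨n, hn, hgn⟩ := h g
    obtain ⟨k, hk⟩ := exists_nat_gt (A * B)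
    have := (hl ((n : ℤ) * k) 0).1
    rw [zpow_mul, zpow_natCast g, hgn] at this
    simp only [one_zpow, zpow_zero, dist_self, Int.cast_zero, sub_zero] at this
    push_cast at this
    rw [abs_of_nonneg (by positivity), sub_nonpos, div_le_iff₀ (by linarith)] at this
    have hn1 : (1 : ℝ) ≤ n := by exact_mod_cast hn
    nlinarith [Nat.cast_nonneg (α := ℝ) k]
end

section
/- Let G be a nilpotent group. Then G has Property (NL) if and only if every group homomorphism from G to the additive group of real numbers ℝ is trivial. -/
namespace NilNL

open scoped commutatorElement

/-- Elements of the abelianization are torsion when all maps to the reals vanish. -/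
lemma pow_mem_commutator {G : Type*} [Group G]
    (H : ∀ f : G → ℝ, (∀ g h : G, f (g * h) = f g + f h) → ∀ g : G, f g = 0) (g : G) :
    ∃ n : ℕ, 0 < n ∧ g ^ n ∈ commutator G := by
  by_contra hcon
  push Not at hcon
  let x : Additive (Abelianization G) := Additive.ofMul (Abelianization.of g)
  have hx : ∀ n : ℕ, 0 < n → n • x ≠ 0 := by
    intro n hn h0
    apply hcon n hn
    have h1 : Abelianization.of (g ^ n) = 1 := by
      rw [map_pow]
      exact h0
    rw [← Abelianization.ker_of G]
    exact h1
  have hinj : Function.Injective (zmultiplesHom (Additive (Abelianization G)) x) := by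
    rw [injective_iff_map_eq_zero]
    intro n hn
    rw [zmultiplesHom_apply] at hn
    by_contra hne
    have hpos : 0 < n.natAbs := Int.natAbs_pos.mpr hne
    apply hx _ hpos
    rcases Int.natAbs_eq n with h | h
    · rw [h, natCast_zsmul] at hn
      exact hn
    · rw [h, neg_zsmul, natCast_zsmul, neg_eq_zero] at hn
      exact hn
  obtain ⟨φ, hφ⟩ := (Module.Baer.of_divisible ℝ).extension_property_addMonoidHom
    (zmultiplesHom (Additive (Abelianization G)) x) hinj (Int.castAddHom ℝ)
  have h1 : φ x = 1 := by
    have := DFunLike.congr_fun hφ 1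
    simpa using this
  have h2 := H (fun y => φ (Additive.ofMul (Abelianization.of y)))
    (fun a b => by simp) g
  have h3 : φ x = 0 := h2
  rw [h1] at h3
  exact one_ne_zero h3

lemma pow_mem_lcs {G : Type*} [Group G]
    (H : ∀ g : G, ∃ n : ℕ, 0 < n ∧ g ^ n ∈ commutator G) (i : ℕ) :
    ∀ g : G, ∃ n : ℕ, 0 < n ∧ g ^ n ∈ (⊤ : Subgroup G).lowerCentralSeries (i + 1) := by
  induction i with
  | zero =>
    intro g
    rw [zero_add, Subgroup.top_lowerCentralSeries_one]
    exact H g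
  | succ i ih =>
    set N := (⊤ : Subgroup G).lowerCentralSeries (i + 1 + 1) with hN
    let π : G →* G ⧸ N := QuotientGroup.mk' N
    have hπ : ∀ z, π z = 1 ↔ z ∈ N := fun z => QuotientGroup.eq_one_iff z
    have hcent : ∀ z ∈ (⊤ : Subgroup G).lowerCentralSeries (i + 1), ∀ y,
        Commute (π z) (π y) := by
      intro z hz y
      have h : ⁅z, y⁆ ∈ N := Subgroup.commutator_mem_commutator hz (Subgroup.mem_top y)
      rw [← hπ, map_commutatorElement, commutatorElement_eq_one_iff_commute] at h
      exact h
    have key : ∀ z ∈ (⊤ : Subgroup G).lowerCentralSeries (i + 1),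
        ∃ n : ℕ, 0 < n ∧ (π z) ^ n = 1 := by
      intro z hz
      have hz' := hz
      rw [Subgroup.mem_lowerCentralSeries_succ_iff] at hz'
      induction hz' using Subgroup.closure_induction with
      | mem z hzm =>
        obtain ⟨x, hx, y, -, rfl⟩ := hzm
        obtain ⟨n, hn, hxn⟩ := ih x
        refine ⟨n, hn, ?_⟩
        have hc := hcent _ hz
        have e1 : π y * π x * (π y)⁻¹ = (π ⁅x, y⁆)⁻¹ * π x := by
          rw [map_commutatorElement, commutatorElement_def]; group
        have e2 : (π y * π x * (π y)⁻¹) ^ n = π x ^ n := by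
          have h := (hcent _ hxn y).eq
          rw [map_pow] at h
          rw [conj_pow, ← h, mul_inv_cancel_right]
        rw [e1, (hc x).inv_left.mul_pow, mul_eq_right, inv_pow, inv_eq_one] at e2
        exact e2
      | one => exact ⟨1, one_pos, by simp⟩
      | mul a b ha hb iha ihb =>
        have ha' : a ∈ (⊤ : Subgroup G).lowerCentralSeries (i + 1) := ha
        have hb' : b ∈ (⊤ : Subgroup G).lowerCentralSeries (i + 1) := hb
        obtain ⟨n, hn, h1⟩ := iha ha'
        obtain ⟨m, hm, h2⟩ := ihb hb'
        refine ⟨n * m, Nat.mul_pos hn hm, ?_⟩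
        rw [map_mul, (hcent a ha' b).mul_pow, pow_mul, h1, mul_comm n m, pow_mul, h2]
        simp
      | inv a ha iha =>
        have ha' : a ∈ (⊤ : Subgroup G).lowerCentralSeries (i + 1) := ha
        obtain ⟨n, hn, h1⟩ := iha ha'
        exact ⟨n, hn, by rw [map_inv, inv_pow, h1, inv_one]⟩
    intro g
    obtain ⟨n, hn, h⟩ := ih g
    obtain ⟨m, hm, h'⟩ := key _ h
    refine ⟨n * m, Nat.mul_pos hn hm, ?_⟩
    rw [← hπ, pow_mul, map_pow]
    exact h'

lemma real_geodesic : IsGeodesicSpace ℝ := by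
  intro x y
  rcases le_total x y with h | h
  · refine ⟨fun t => x + t, by simp, ?_, ?_⟩
    · rw [Real.dist_eq, abs_sub_comm, abs_of_nonneg (by linarith)]; ring
    · intro s _ t _
      rw [Real.dist_eq]; congr 1; ring
  · refine ⟨fun t => x - t, by simp, ?_, ?_⟩
    · rw [Real.dist_eq, abs_of_nonneg (by linarith)]; ring
    · intro s _ t _
      rw [Real.dist_eq, abs_sub_comm]; congr 1; ring

lemma real_hyperbolic : IsGromovHyperbolic ℝ := by
  refine ⟨0, le_rfl, ?_⟩
  intro x y z w
  simp only [Real.dist_eq, mul_zero, add_zero]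
  rw [le_max_iff]
  by_contra hcon
  push Not at hcon
  obtain ⟨h1, h2⟩ := hcon
  have a1 := le_abs_self (x - z)
  have a2 := neg_abs_le (x - z)
  have a3 := le_abs_self (y - w)
  have a4 := neg_abs_le (y - w)
  have a5 := le_abs_self (x - w)
  have a6 := neg_abs_le (x - w)
  have a7 := le_abs_self (y - z)
  have a8 := neg_abs_le (y - z)
  rcases abs_cases (x - y) with ⟨e1, _⟩ | ⟨e1, _⟩ <;>
  rcases abs_cases (z - w) with ⟨e2, _⟩ | ⟨e2, _⟩ <;>
  rw [e1, e2] at h1 h2 <;> linarith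

end NilNL

/-- A nilpotent group has Property (NL) if and only if every homomorphism
to the additive reals is trivial. -/
theorem nilpotent_propertyNL_iff (G : Type*) [Group G] [Group.IsNilpotent G] :
    PropertyNL G ↔
      ∀ f : G → ℝ, (∀ g h : G, f (g * h) = f g + f h) → ∀ g : G, f g = 0 := by
  constructor
  · intro hNL f hf g
    by_contra hne
    have hpos : 0 < |f g| := abs_pos.mpr hne
    have f1 : f 1 = 0 := by
      have := hf 1 1
      rw [mul_one] at this
      linarith
    let F : G →* Multiplicative ℝ :=
      { toFun := fun g => Multiplicative.ofAdd (f g)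
        map_one' := by rw [f1]; rfl
        map_mul' := fun a b => by rw [hf]; rfl }
    have hz : ∀ n : ℤ, f (g ^ n) = n * f g := by
      intro n
      have h : F (g ^ n) = F g ^ n := map_zpow F g n
      have h' : f (g ^ n) = n • f g := h
      rw [h', zsmul_eq_mul]
    refine hNL ℝ NilNL.real_geodesic NilNL.real_hyperbolic (fun g x => f g + x)
      ⟨fun x => by simp [f1], fun a b x => by simp only [hf]; ring,
        fun a x y => by simp⟩ g ?_
    refine ⟨0, 1 + |f g| + |f g|⁻¹, 0, ?_, le_rfl, ?_⟩
    · have := inv_pos.mpr hpos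
      linarith
    · intro m n
      have hi := inv_pos.mpr hpos
      have hd : dist (f (g ^ m) + 0) (f (g ^ n) + 0) = |(m : ℝ) - n| * |f g| := by
        rw [Real.dist_eq, hz, hz, ← abs_mul]; congr 1; ring
      have hab := abs_nonneg ((m : ℝ) - n)
      rw [hd]
      have hA : 1 ≤ |f g| * (1 + |f g| + |f g|⁻¹) := by
        have : |f g| * |f g|⁻¹ = 1 := mul_inv_cancel₀ hpos.ne'
        nlinarith
      constructor
      · rw [sub_zero, div_le_iff₀ (by linarith), mul_assoc]
        exact le_mul_of_one_le_right hab hA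
      · rw [add_zero, mul_comm]
        exact mul_le_mul_of_nonneg_right (by linarith) hab
  · intro H X _ _ _ a ha g hlox
    obtain ⟨c, hc⟩ := Subgroup.nilpotent_iff_lowerCentralSeries.mp (inferInstance : Group.IsNilpotent G)
    obtain ⟨n, hn, hgn⟩ := NilNL.pow_mem_lcs (NilNL.pow_mem_commutator H) c g
    have hg1 : g ^ n = 1 := by
      have := Subgroup.lowerCentralSeries_antitone (⊤ : Subgroup G) (Nat.le_succ c) hgn
      rw [hc] at this
      exact Subgroup.mem_bot.mp this
    obtain ⟨x, A, B, hA, hB, h⟩ := hlox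
    obtain ⟨k, hk⟩ := exists_nat_gt (A * B)
    have h1 := (h ((n : ℤ) * k) 0).1
    have e : g ^ ((n : ℤ) * k) = 1 := by
      rw [zpow_mul, zpow_natCast g n, hg1, one_zpow]
    rw [e, zpow_zero, dist_self] at h1
    push_cast at h1
    rw [sub_zero, abs_of_nonneg (by positivity)] at h1
    have h2 : (n : ℝ) * k / A ≤ B := by linarith
    rw [div_le_iff₀ (by linarith)] at h2
    have hn1 : (1 : ℝ) ≤ n := by exact_mod_cast hn
    have hk0 : (0 : ℝ) ≤ k := by positivity
    nlinarith
end

section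
/- If a group G has Property (NL) and N is a normal subgroup of G, then the quotient group G/N has Property (NL). -/
/-- Property (NL) passes to quotients. -/
theorem propertyNL_quotient {G : Type*} [Group G] (hG : PropertyNL G)
    (N : Subgroup G) [N.Normal] : PropertyNL (G ⧸ N) := by
  intro X _ hgeo hhyp a ha q hq
  obtain ⟨g, rfl⟩ := QuotientGroup.mk_surjective q
  obtain ⟨h1, hmul, hdist⟩ := ha
  refine hG X hgeo hhyp (fun g x => a (g : G ⧸ N) x) ⟨?_, ?_, ?_⟩ g ?_
  · intro x
    exact h1 x
  · intro g h x
    exact hmul (g : G ⧸ N) (h : G ⧸ N) x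
  · intro g x y
    exact hdist _ x y
  · obtain ⟨x, A, B, hA, hB, h⟩ := hq
    exact ⟨x, A, B, hA, hB, fun m n => h m n⟩
end

section
/- Let G be a group and (H_i)_{i ∈ ι} a family of subgroups of G which is directed (for all i, j ∈ ι there exists k ∈ ι with H_i ≤ H_k and H_j ≤ H_k) and whose union is all of G. If every H_i has Property (NL), then G has Property (NL). -/
/-- Property (NL) is preserved under directed unions of subgroups. -/
theorem propertyNL_directed_union {G : Type*} [Group G] {ι : Type*}
    (H : ι → Subgroup G)
    (hdir : ∀ i j : ι, ∃ k : ι, H i ≤ H k ∧ H j ≤ H k)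
    (hunion : ∀ g : G, ∃ i : ι, g ∈ H i)
    (hNL : ∀ i : ι, PropertyNL (H i)) : PropertyNL G := by
  intro X _ hgeo hhyp a ha g hg
  obtain ⟨i, hi⟩ := hunion g
  refine hNL i X hgeo hhyp (fun h x => a (h : G) x) ⟨?_, ?_, ?_⟩ ⟨g, hi⟩ ?_
  · intro x
    simpa using ha.1 x
  · intro h k x
    simpa using ha.2.1 (h : G) (k : G) x
  · intro h x y
    exact ha.2.2 (h : G) x y
  · obtain ⟨x, A, B, hA, hB, hq⟩ := hg
    refine ⟨x, A, B, hA, hB, fun m n => ?_⟩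
    simpa using hq m n
end

section
/- If groups A and B both have Property (NL), then the direct product A × B has Property (NL). -/
open Filter Topology in
/-- A non-loxodromic isometry has vanishing stable translation length. -/
theorem tendsto_of_not_loxodromic {G : Type*} [Group G] {X : Type*} [MetricSpace X]
    {a : G → X → X} (ha : IsIsometricAction G X a) {g : G} (hg : ¬ IsLoxodromic G X a g) (x : X) :
    Tendsto (fun n : ℕ => dist (a (g ^ n) x) x / n) atTop (𝓝 0) := by
  obtain ⟨h1, hmul, hiso⟩ := ha
  have hsub : Subadditive (fun n : ℕ => dist (a (g ^ n) x) x) := by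
    intro m n
    have h := dist_triangle (a (g ^ (m + n)) x) (a (g ^ m) x) x
    rw [pow_add, hmul, hiso] at h
    simp only [pow_add, hmul]
    linarith
  have hbdd : BddBelow (Set.range fun n : ℕ => dist (a (g ^ n) x) x / n) :=
    ⟨0, by rintro _ ⟨n, rfl⟩; positivity⟩
  have ht := hsub.tendsto_lim hbdd
  have h0 : 0 ≤ hsub.lim := ge_of_tendsto' ht (fun n => by positivity)
  rcases h0.eq_or_lt with h | hpos
  · rwa [← h] at ht
  exfalso
  apply hg
  have hlow : ∀ n : ℕ, n * hsub.lim ≤ dist (a (g ^ n) x) x := by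
    intro n
    rcases Nat.eq_zero_or_pos n with rfl | hn
    · simp
    · have := hsub.lim_le_div hbdd hn.ne'
      rw [le_div_iff₀ (by exact_mod_cast hn)] at this
      linarith
  have hup : ∀ n : ℕ, dist (a (g ^ n) x) x ≤ dist (a g x) x * n := by
    intro n
    induction n with
    | zero => simp [h1]
    | succ k ih =>
      have := hsub k 1
      simp only [pow_one] at this
      push_cast
      linarith
  have key : ∀ m n : ℤ, ∃ k : ℕ, (k : ℝ) = |(m : ℝ) - n| ∧
      dist (a (g ^ m) x) (a (g ^ n) x) = dist (a (g ^ k) x) x := by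
    have aux : ∀ (n : ℤ) (k : ℕ),
        dist (a (g ^ (n + k)) x) (a (g ^ n) x) = dist (a (g ^ k) x) x := by
      intro n k
      rw [zpow_add, hmul, hiso, zpow_natCast]
    intro m n
    rcases le_total n m with h | h
    · obtain ⟨k, rfl⟩ := Int.le.dest h
      exact ⟨k, by simp, aux n k⟩
    · obtain ⟨k, rfl⟩ := Int.le.dest h
      exact ⟨k, by simp, by rw [dist_comm]; exact aux m k⟩
  refine ⟨x, max 1 (max (1 / hsub.lim) (dist (a g x) x)), 0, le_max_left _ _, le_rfl, ?_⟩
  intro m n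
  obtain ⟨k, hk, hd⟩ := key m n
  rw [hd, ← hk]
  set C := max 1 (max (1 / hsub.lim) (dist (a g x) x)) with hC
  have hC1 : 1 ≤ C := le_max_left _ _
  have hC2 : 1 / hsub.lim ≤ C := (le_max_left _ _).trans (le_max_right _ _)
  have hC3 : dist (a g x) x ≤ C := (le_max_right _ _).trans (le_max_right _ _)
  have hk0 : (0 : ℝ) ≤ k := k.cast_nonneg
  constructor
  · rw [sub_zero]
    refine le_trans ?_ (hlow k)
    rw [div_le_iff₀ (by linarith)]
    rw [div_le_iff₀ hpos] at hC2
    nlinarith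
  · have := hup k
    nlinarith

open Filter Topology in
/-- Property (NL) is preserved under direct products. -/
theorem propertyNL_prod {A B : Type*} [Group A] [Group B]
    (hA : PropertyNL A) (hB : PropertyNL B) : PropertyNL (A × B) := by
  intro X _ hgeo hhyp a ha g hg
  obtain ⟨x, C, D, hC, hD, hlox⟩ := hg
  have hactA : IsIsometricAction A X (fun p => a (p, 1)) := by
    refine ⟨ha.1, fun p q y => ?_, fun p => ha.2.2 _⟩
    simp only [← ha.2.1, Prod.mk_mul_mk, mul_one]
  have hactB : IsIsometricAction B X (fun p => a (1, p)) := by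
    refine ⟨ha.1, fun p q y => ?_, fun p => ha.2.2 _⟩
    simp only [← ha.2.1, Prod.mk_mul_mk, mul_one]
  have tA := tendsto_of_not_loxodromic hactA (hA X hgeo hhyp _ hactA g.1) x
  have tB := tendsto_of_not_loxodromic hactB (hB X hgeo hhyp _ hactB g.2) x
  have tS := tA.add tB
  have tD : Tendsto (fun n : ℕ => D / (n : ℝ)) atTop (𝓝 0) :=
    tendsto_const_div_atTop_nhds_zero_nat D
  have tT := tS.add tD
  have hle : 1 / C ≤ 0 + 0 + 0 := by
    refine ge_of_tendsto tT ?_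
    filter_upwards [eventually_gt_atTop 0] with n hn
    have hn' : (0 : ℝ) < n := by exact_mod_cast hn
    have h := (hlox n 0).1
    have e : g ^ n = (g.1 ^ n, 1) * (1, g.2 ^ n) := by ext <;> simp
    simp only [zpow_natCast, zpow_zero, ha.1, Int.cast_natCast, Int.cast_zero, sub_zero,
      Nat.abs_cast] at h
    have h2 := dist_triangle (a (g ^ n) x) (a (g.1 ^ n, 1) x) x
    have h3 : dist (a (g ^ n) x) (a (g.1 ^ n, 1) x) = dist (a (1, g.2 ^ n) x) x := by
      rw [e, ha.2.1, ha.2.2]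
    rw [← add_div, ← add_div, le_div_iff₀ hn']
    have : 1 / C * n = n / C := by ring
    linarith
  have : 0 < 1 / C := by positivity
  linarith
end

section
/- Let G₀ be a finite-index subgroup of a group G. If G₀ has Property (NL), then G has Property (NL). -/
/-- If a finite-index subgroup has Property (NL), then so does the whole group. -/
theorem propertyNL_of_finiteIndex_subgroup {G : Type*} [Group G]
    (G₀ : Subgroup G) (hfi : G₀.FiniteIndex) (h : PropertyNL G₀) :
    PropertyNL G := by
  intro X _ hgeo hhyp a ha g hg
  obtain ⟨k, hk0, -, hk⟩ := Subgroup.exists_pow_mem_of_index_ne_zero hfi.index_ne_zero g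
  obtain ⟨x, A, B, hA, hB, hAB⟩ := hg
  have hk1 : (1 : ℝ) ≤ k := by exact_mod_cast hk0
  refine h X hgeo hhyp (fun g x => a (g : G) x)
    ⟨fun x => ha.1 x, fun g h x => ha.2.1 g h x, fun g x y => ha.2.2 g x y⟩ ⟨g ^ k, hk⟩
    ⟨x, A * k, B, by nlinarith, hB, fun m n => ?_⟩
  have key : ∀ m : ℤ, (((⟨g ^ k, hk⟩ : G₀) ^ m : G₀) : G) = g ^ ((k : ℤ) * m) := by
    intro m
    rw [zpow_mul]
    simp
  have habs : |(((k : ℤ) * m : ℤ) : ℝ) - (((k : ℤ) * n : ℤ) : ℝ)| = k * |(m : ℝ) - n| := by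
    push_cast
    rw [← mul_sub, abs_mul, abs_of_nonneg (by positivity)]
  have h2 := hAB (k * m) (k * n)
  rw [habs] at h2
  simp only [key]
  refine ⟨le_trans ?_ h2.1, h2.2.trans_eq (by ring)⟩
  have h0 := abs_nonneg ((m : ℝ) - n)
  have hA0 : 0 < A := by linarith
  gcongr
  · nlinarith
  · nlinarith
end

section
/- Let G and H be groups which are commensurable, i.e. there exist a finite-index subgroup G₀ of G and a finite-index subgroup H₀ of H such that G₀ and H₀ are isomorphic as groups. If G has hereditary (NL), then H has hereditary (NL). -/
/-- A group has hereditary (NL) if every finite-index subgroup has Property (NL). -/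
def HereditaryNL (G : Type*) [Group G] : Prop :=
  ∀ H : Subgroup G, H.FiniteIndex → PropertyNL H

/-- Hereditary (NL) is invariant under commensurability. -/
theorem hereditaryNL_of_commensurable {G H : Type*} [Group G] [Group H]
    (G₀ : Subgroup G) (H₀ : Subgroup H)
    (hG₀ : G₀.FiniteIndex) (hH₀ : H₀.FiniteIndex)
    (hiso : Nonempty (G₀ ≃* H₀))
    (hG : HereditaryNL G) : HereditaryNL H := by
  obtain ⟨e⟩ := hiso
  intro K hK X _ hgeo hhyp a ha k hk
  let L₀ : Subgroup G₀ := (K.subgroupOf H₀).comap e.toMonoidHom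
  let L : Subgroup G := L₀.map G₀.subtype
  have hL : L.FiniteIndex := by
    constructor
    have h1 : L₀.index ≠ 0 := by
      have : L₀.index = (K.subgroupOf H₀).index :=
        Subgroup.index_comap_of_surjective _ e.surjective
      rw [this]
      exact Subgroup.FiniteIndex.index_ne_zero
    rw [Subgroup.index_map_subtype]
    exact mul_ne_zero h1 hG₀.index_ne_zero
  have hLG : L ≤ G₀ := Subgroup.map_subtype_le L₀
  let ψ : L →* H := H₀.subtype.comp (e.toMonoidHom.comp (Subgroup.inclusion hLG))
  have hψ : ∀ x : L, ψ x ∈ K := by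
    rintro ⟨x, y, hy, rfl⟩
    exact hy
  let φ : L →* K := ψ.codRestrict K hψ
  obtain ⟨n, hn, -, hkn⟩ := Subgroup.exists_pow_mem_of_index_ne_zero hH₀.index_ne_zero (k : H)
  obtain ⟨g, hg⟩ : ∃ g : L, φ g = k ^ n := by
    refine ⟨⟨(e.symm ⟨(k : H) ^ n, hkn⟩ : G₀), ⟨e.symm ⟨(k : H) ^ n, hkn⟩, ?_, rfl⟩⟩, ?_⟩
    · change ((e (e.symm ⟨(k : H) ^ n, hkn⟩) : H₀) : H) ∈ K
      rw [e.apply_symm_apply]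
      exact K.pow_mem k.2 n
    · apply Subtype.ext
      change ((e (e.symm ⟨(k : H) ^ n, hkn⟩) : H₀) : H) = _
      rw [e.apply_symm_apply]
      simp
  refine hG L hL X hgeo hhyp (fun l x => a (φ l) x) ⟨?_, ?_, ?_⟩ g ?_
  · intro x; simp only [map_one]; exact ha.1 x
  · intro p q x; simp only [map_mul]; exact ha.2.1 _ _ x
  · intro p x y; exact ha.2.2 _ x y
  · obtain ⟨x, A, B, hA, hB, h⟩ := hk
    have hn1 : (1 : ℝ) ≤ n := by exact_mod_cast hn
    refine ⟨x, A * n, B, by nlinarith, hB, fun p q => ?_⟩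
    have key : ∀ p : ℤ, φ (g ^ p) = k ^ ((n : ℤ) * p) := by
      intro p; rw [map_zpow, hg, zpow_mul, zpow_natCast]
    simp only [key]
    have h2 := h (n * p) (n * q)
    have habs : |(((n : ℤ) * p : ℤ) : ℝ) - (((n : ℤ) * q : ℤ) : ℝ)| = n * |(p : ℝ) - q| := by
      push_cast
      rw [← mul_sub, abs_mul, Nat.abs_cast]
    rw [habs] at h2
    have h0 := abs_nonneg ((p : ℝ) - q)
    refine ⟨le_trans ?_ h2.1, h2.2.trans (by linarith)⟩
    gcongr
    · nlinarith
    · nlinarith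
end

section
/- Let G be a group and N a normal subgroup of G. If N has Property (NL) and the quotient G/N has Property (NL), then G has Property (NL). -/
/-- A pseudometric, 4-point hyperbolic, invariant under the action of a group. -/
structure HypPM (G : Type*) (Y : Type*) [Group G] [MulAction G Y] (d : Y → Y → ℝ) (δ : ℝ) :
    Prop where
  self : ∀ x, d x x = 0
  symm : ∀ x y, d x y = d y x
  tri : ∀ x y z, d x z ≤ d x y + d y z
  inv : ∀ (g : G) x y, d (g • x) (g • y) = d x y
  hyp : ∀ x y z w, d x y + d z w ≤ max (d x z + d y w) (d x w + d y z) + 2 * δ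

namespace HypPM

variable {G Y : Type*} [Group G] [MulAction G Y] {d : Y → Y → ℝ} {δ : ℝ}

theorem nonneg (H : HypPM G Y d δ) (x y : Y) : 0 ≤ d x y := by
  have h1 := H.tri x y x
  rw [H.self, H.symm y x] at h1
  linarith

theorem inv_pow (H : HypPM G Y d δ) (h : G) (x : Y) (i j : ℕ) :
    d (h ^ i • x) (h ^ (i + j) • x) = d x (h ^ j • x) := by
  rw [pow_add, mul_smul, H.inv]

theorem crit (H : HypPM G Y d δ) (h : G) (x : Y)
    (hx : d x (h • x) + 2 * δ < d x (h ^ 2 • x)) :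
    ∃ ε : ℝ, 0 < ε ∧ ∀ k : ℕ, ε * k - ε ≤ d x (h ^ k • x) := by
  set ε := d x (h ^ 2 • x) - d x (h • x) - 2 * δ with hε
  have hε0 : 0 < ε := by linarith
  refine ⟨ε, hε0, ?_⟩
  have key : ∀ k : ℕ, d x (h ^ (k + 1) • x) ≥ d x (h ^ k • x) ∧ 
      d x (h ^ (k + 2) • x) ≥ d x (h ^ (k + 1) • x) + ε := by
    have step : ∀ k : ℕ, d x (h ^ (k + 1) • x) ≥ d x (h ^ k • x) → 
      d x (h ^ (k + 2) • x) ≥ d x (h ^ (k + 1) • x) + ε := by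
      intro k hk
      have h1 := H.hyp x (h ^ (k + 1) • x) (h ^ k • x) (h ^ (k + 2) • x)
      have e1 := H.inv_pow h x k 2
      have e2 := H.inv_pow h x (k + 1) 1
      have e3 := H.inv_pow h x k 1
      rw [H.symm (h ^ (k + 1) • x) (h ^ k • x)] at h1
      rw [show k + 1 + 1 = k + 2 from rfl] at e2
      rw [pow_one] at e2 e3
      rw [e1, e2, e3] at h1
      rcases max_cases (d x (h ^ k • x) + d x (h • x)) (d x (h ^ (k + 2) • x) + d x (h • x))
        with ⟨h2, _⟩ | ⟨h2, _⟩ <;> rw [h2] at h1 <;> linarith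
    intro k
    induction k with
    | zero =>
      have : d x (h ^ (0 + 1) • x) ≥ d x (h ^ 0 • x) := by
        simp only [pow_zero, one_smul, H.self]; exact H.nonneg _ _
      exact ⟨this, step 0 this⟩
    | succ k ih =>
      have : d x (h ^ (k + 1 + 1) • x) ≥ d x (h ^ (k + 1) • x) := by
        have := ih.2
        rw [show k + 1 + 1 = k + 2 from rfl]
        linarith
      exact ⟨this, step (k + 1) this⟩
  intro k
  cases k with
  | zero =>
    have := H.nonneg x (h ^ 0 • x)
    push_cast; linarith
  | succ k =>
    induction k with
    | zero =>
      have := H.nonneg x (h ^ (0 + 1) • x)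
      push_cast; linarith
    | succ k ih =>
      have := (key k).2
      push_cast at *
      rw [show k + 1 + 1 = k + 2 from rfl]
      linarith

theorem upper (H : HypPM G Y d δ) (h : G) (x : Y) (k : ℕ) :
    d x (h ^ k • x) ≤ k * d x (h • x) := by
  induction k with
  | zero => simp [H.self]
  | succ k ih =>
    have h1 := H.tri x (h ^ k • x) (h ^ (k + 1) • x)
    rw [H.inv_pow h x k 1, pow_one] at h1
    push_cast
    linarith

theorem zpow_eq (H : HypPM G Y d δ) (h : G) (x : Y) (m n : ℤ) :
    d (h ^ m • x) (h ^ n • x) = d x (h ^ (m - n).natAbs • x) := by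
  have e1 : ∀ (p q : ℤ) (k : ℕ), q = p + k → d (h ^ p • x) (h ^ q • x) = d x (h ^ k • x) := by
    intro p q k e
    rw [e, zpow_add, mul_smul, H.inv, zpow_natCast]
  rcases le_total m n with hmn | hmn
  · exact e1 m n _ (by omega)
  · rw [H.symm]
    exact e1 n m _ (by omega)

theorem lox (H : HypPM G Y d δ) (h : G) (x : Y) {ε B : ℝ} (hε : 0 < ε)
    (hx : ∀ k : ℕ, ε * k - B ≤ d x (h ^ k • x)) :
    ∃ A B : ℝ, 1 ≤ A ∧ 0 ≤ B ∧ ∀ m n : ℤ,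
      |(m : ℝ) - (n : ℝ)| / A - B ≤ d (h ^ m • x) (h ^ n • x) ∧
      d (h ^ m • x) (h ^ n • x) ≤ A * |(m : ℝ) - (n : ℝ)| + B := by
  refine ⟨max 1 (max ε⁻¹ (d x (h • x))), |B|, le_max_left _ _, abs_nonneg _, ?_⟩
  intro m n
  rw [H.zpow_eq]
  have e : |(m : ℝ) - (n : ℝ)| = ((m - n).natAbs : ℝ) := by
    rw [Nat.cast_natAbs]; push_cast; rfl
  rw [e]
  set k := (m - n).natAbs
  set A := max 1 (max ε⁻¹ (d x (h • x)))
  have hA1 : 1 ≤ A := le_max_left _ _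
  have hA2 : ε⁻¹ ≤ A := (le_max_left _ _).trans (le_max_right _ _)
  have hA3 : d x (h • x) ≤ A := (le_max_right _ _).trans (le_max_right _ _)
  have hk : (0 : ℝ) ≤ k := Nat.cast_nonneg _
  constructor
  · have h1 : (k : ℝ) / A ≤ ε * k := by
      rw [div_le_iff₀ (by linarith)]
      have : 1 ≤ ε * A := by
        have := mul_le_mul_of_nonneg_left hA2 hε.le
        rwa [mul_inv_cancel₀ hε.ne'] at this
      nlinarith
    have := hx k
    have := le_abs_self B
    linarith
  · have := H.upper h x k
    have := abs_nonneg B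
    nlinarith

end HypPM

section Hull

variable {Y : Type} (d : Y → Y → ℝ)

/-- The injective hull of a pseudometric. -/
def Hull : Type :=
  {f : Y → ℝ // (∀ x y, d x y ≤ f x + f y) ∧ ∀ x, ∀ ε > 0, ∃ y, f x + f y ≤ d x y + ε}

variable {d}

theorem Hull.lip (tri : ∀ x y z, d x z ≤ d x y + d y z) (f : Hull d) (x z : Y) :
    f.1 x ≤ d x z + f.1 z := by
  apply le_of_forall_pos_le_add
  intro ε hε
  obtain ⟨y, hy⟩ := f.2.2 x ε hε
  have := tri x z y
  have := f.2.1 z y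
  linarith

theorem Hull.bdd (tri : ∀ x y z, d x z ≤ d x y + d y z) (f g : Hull d) :
    BddAbove (Set.range fun x => |f.1 x - g.1 x|) := by
  rcases isEmpty_or_nonempty Y with hY | ⟨⟨o⟩⟩
  · exact ⟨0, by rintro _ ⟨x, _⟩; exact hY.elim x⟩
  · refine ⟨f.1 o + g.1 o, ?_⟩
    rintro _ ⟨x, rfl⟩
    have := f.lip tri x o
    have := g.lip tri x o
    have := f.2.1 x o
    have := g.2.1 x o
    simp only
    rw [abs_le]; constructor <;> linarith

/-- The sup metric on the hull. -/
@[reducible] noncomputable def Hull.metric [Nonempty Y] (tri : ∀ x y z, d x z ≤ d x y + d y z) :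
    MetricSpace (Hull d) where
  dist f g := ⨆ x, |f.1 x - g.1 x|
  dist_self f := by simp
  dist_comm f g := by simp only [abs_sub_comm]
  dist_triangle f g h := by
    apply ciSup_le
    intro x
    have h1 := le_ciSup (Hull.bdd tri f g) x
    have h2 := le_ciSup (Hull.bdd tri g h) x
    exact (abs_sub_le _ (g.1 x) _).trans (add_le_add h1 h2)
  eq_of_dist_eq_zero := by
    intro f g h
    apply Subtype.ext
    funext x
    have h1 := le_ciSup (Hull.bdd tri f g) x
    have h2 : (⨆ x, |f.1 x - g.1 x|) = 0 := h
    rw [h2] at h1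
    have := abs_nonpos_iff.1 h1
    linarith

theorem Hull.hyperbolic [Nonempty Y] (tri : ∀ x y z, d x z ≤ d x y + d y z)
    (symm : ∀ x y, d x y = d y x) {δ : ℝ} (hδ : 0 ≤ δ)
    (hyp : ∀ x y z w, d x y + d z w ≤ max (d x z + d y w) (d x w + d y z) + 2 * δ) :
    letI := Hull.metric tri
    IsGromovHyperbolic (Hull d) := by
  letI := Hull.metric tri
  have low : ∀ (f g : Hull d) x y, d x y - f.1 x - g.1 y ≤ dist f g := by
    intro f g x y
    have h1 : |f.1 x - g.1 x| ≤ dist f g := le_ciSup (Hull.bdd tri f g) x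
    have := neg_abs_le (f.1 x - g.1 x)
    have := g.2.1 x y
    linarith
  have up : ∀ (f g : Hull d), ∀ η > 0, ∃ x y, dist f g ≤ d x y - f.1 x - g.1 y + η := by
    intro f g η hη
    have : dist f g - η / 2 < ⨆ x, |f.1 x - g.1 x| := by
      change dist f g - η / 2 < dist f g
      linarith
    obtain ⟨x, hx⟩ := exists_lt_of_lt_ciSup this
    rcases abs_cases (f.1 x - g.1 x) with ⟨h, _⟩ | ⟨h, _⟩
    · obtain ⟨y, hy⟩ := f.2.2 x (η / 2) (by linarith)
      refine ⟨y, x, ?_⟩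
      rw [symm y x]; linarith
    · obtain ⟨y, hy⟩ := g.2.2 x (η / 2) (by linarith)
      exact ⟨x, y, by linarith⟩
  refine ⟨δ, hδ, ?_⟩
  intro f g h k
  apply le_of_forall_pos_le_add
  intro η hη
  obtain ⟨x, y, h1⟩ := up f g (η / 2) (by linarith)
  obtain ⟨z, w, h2⟩ := up h k (η / 2) (by linarith)
  have h3 := hyp x y z w
  have a1 := low f h x z
  have a2 := low g k y w
  have a3 := low f k x w
  have a4 := low g h y z
  have m1 := le_max_left (dist f h + dist g k) (dist f k + dist g h)
  have m2 := le_max_right (dist f h + dist g k) (dist f k + dist g h)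
  rcases max_cases (d x z + d y w) (d x w + d y z) with ⟨h4, _⟩ | ⟨h4, _⟩ <;>
    rw [h4] at h3 <;> linarith

/-- The conjugate function. -/
noncomputable def hconj (d : Y → Y → ℝ) (f : Y → ℝ) (x : Y) : ℝ := ⨆ y, (d x y - f y)

/-- Averaging with the conjugate. -/
noncomputable def havg (d : Y → Y → ℝ) (f : Y → ℝ) (x : Y) : ℝ := (f x + hconj d f x) / 2

theorem hconj_bdd {f : Y → ℝ} (hf : ∀ x y, d x y ≤ f x + f y) (x : Y) :
    BddAbove (Set.range fun y => d x y - f y) := by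
  refine ⟨f x, ?_⟩
  rintro _ ⟨y, rfl⟩
  have := hf x y
  simp only; linarith

theorem le_hconj {f : Y → ℝ} (hf : ∀ x y, d x y ≤ f x + f y) (x y : Y) :
    d x y - f y ≤ hconj d f x := le_ciSup (hconj_bdd hf x) y

theorem hconj_le [Nonempty Y] {f : Y → ℝ} (hf : ∀ x y, d x y ≤ f x + f y) (x : Y) :
    hconj d f x ≤ f x := by
  apply ciSup_le
  intro y
  have := hf x y
  linarith

theorem havg_mem {f : Y → ℝ} (symm : ∀ x y, d x y = d y x) (hf : ∀ x y, d x y ≤ f x + f y) :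
    ∀ x y, d x y ≤ havg d f x + havg d f y := by
  intro x y
  have h1 := le_hconj hf x y
  have h2 := le_hconj hf y x
  rw [symm y x] at h2
  unfold havg
  linarith

theorem havg_le [Nonempty Y] {f : Y → ℝ} (hf : ∀ x y, d x y ≤ f x + f y) (x : Y) :
    havg d f x ≤ f x := by
  have := hconj_le hf x
  unfold havg
  linarith

theorem havg_gap [Nonempty Y] {f : Y → ℝ} (symm : ∀ x y, d x y = d y x)
    (hf : ∀ x y, d x y ≤ f x + f y) (x : Y) :
    havg d f x - hconj d (havg d f) x ≤ (f x - hconj d f x) / 2 := by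
  have : hconj d f x ≤ hconj d (havg d f) x := by
    apply ciSup_le
    intro y
    have h1 := le_hconj (havg_mem symm hf) x y
    have h2 := havg_le hf y
    linarith
  have e : havg d f x = (f x + hconj d f x) / 2 := rfl
  linarith

theorem hconj_lip [Nonempty Y] {f g : Y → ℝ} {c : ℝ} 
    (hg : ∀ x y, d x y ≤ g x + g y) (h : ∀ x, |f x - g x| ≤ c) (x : Y) :
    hconj d f x - hconj d g x ≤ c := by
  have : hconj d f x ≤ hconj d g x + c := by
    apply ciSup_le
    intro y
    have h1 := le_hconj hg x y
    have h2 := abs_le.1 (h y)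
    linarith
  linarith

theorem havg_lip [Nonempty Y] {f g : Y → ℝ} {c : ℝ} (hf : ∀ x y, d x y ≤ f x + f y)
    (hg : ∀ x y, d x y ≤ g x + g y) (h : ∀ x, |f x - g x| ≤ c) (x : Y) :
    |havg d f x - havg d g x| ≤ c := by
  have h1 := hconj_lip hg h x
  have h2 := hconj_lip (f := g) (g := f) hf (fun x => by rw [abs_sub_comm]; exact h x) x
  have h3 := abs_le.1 (h x)
  unfold havg
  rw [abs_le]
  constructor <;> linarith

/-- The retraction onto the hull. -/
noncomputable def hret (d : Y → Y → ℝ) (f : Y → ℝ) (x : Y) : ℝ := ⨅ n : ℕ, (havg d)^[n] f x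

theorem iter_mem {f : Y → ℝ} (symm : ∀ x y, d x y = d y x) (hf : ∀ x y, d x y ≤ f x + f y)
    (n : ℕ) : ∀ x y, d x y ≤ (havg d)^[n] f x + (havg d)^[n] f y := by
  induction n with
  | zero => exact hf
  | succ n ih =>
    rw [Function.iterate_succ_apply']
    exact havg_mem symm ih

theorem iter_anti [Nonempty Y] {f : Y → ℝ} (symm : ∀ x y, d x y = d y x)
    (hf : ∀ x y, d x y ≤ f x + f y) (x : Y) : Antitone fun n : ℕ => (havg d)^[n] f x := by
  apply antitone_nat_of_succ_le
  intro n
  rw [Function.iterate_succ_apply']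
  exact havg_le (iter_mem symm hf n) x

theorem iter_bdd {f : Y → ℝ} (self : ∀ x, d x x = 0) (symm : ∀ x y, d x y = d y x)
    (hf : ∀ x y, d x y ≤ f x + f y) (x : Y) :
    BddBelow (Set.range fun n : ℕ => (havg d)^[n] f x) := by
  refine ⟨0, ?_⟩
  rintro _ ⟨n, rfl⟩
  have := iter_mem symm hf n x x
  rw [self] at this
  simp only; linarith

theorem iter_gap [Nonempty Y] {f : Y → ℝ} (symm : ∀ x y, d x y = d y x)
    (hf : ∀ x y, d x y ≤ f x + f y) (x : Y) (n : ℕ) :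
    (havg d)^[n] f x - hconj d ((havg d)^[n] f) x ≤ (f x - hconj d f x) * (1 / 2) ^ n := by
  induction n with
  | zero => simp
  | succ n ih =>
    rw [Function.iterate_succ_apply']
    have := havg_gap symm (iter_mem symm hf n) x
    rw [pow_succ]
    linarith

theorem iter_tendsto [Nonempty Y] {f : Y → ℝ} (self : ∀ x, d x x = 0)
    (symm : ∀ x y, d x y = d y x) (hf : ∀ x y, d x y ≤ f x + f y) (x : Y) :
    Filter.Tendsto (fun n : ℕ => (havg d)^[n] f x) Filter.atTop (nhds (hret d f x)) :=
  tendsto_atTop_ciInf (iter_anti symm hf x) (iter_bdd self symm hf x)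

theorem hret_mem [Nonempty Y] {f : Y → ℝ} (self : ∀ x, d x x = 0)
    (symm : ∀ x y, d x y = d y x) (hf : ∀ x y, d x y ≤ f x + f y) :
    (∀ x y, d x y ≤ hret d f x + hret d f y) ∧
      ∀ x, ∀ ε > 0, ∃ y, hret d f x + hret d f y ≤ d x y + ε := by
  constructor
  · intro x y
    exact ge_of_tendsto' ((iter_tendsto self symm hf x).add (iter_tendsto self symm hf y))
      (fun n => iter_mem symm hf n x y)
  · intro x ε hε
    have h1 : Filter.Tendsto (fun n : ℕ => (f x - hconj d f x) * (1 / 2 : ℝ) ^ n) Filter.atTop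
        (nhds ((f x - hconj d f x) * 0)) :=
      (tendsto_pow_atTop_nhds_zero_of_lt_one (by norm_num) (by norm_num)).const_mul _
    rw [mul_zero] at h1
    obtain ⟨n, hn⟩ := (h1.eventually (gt_mem_nhds hε)).exists
    have h2 := iter_gap symm hf x n
    have h3 : (havg d)^[n] f x - ε < ⨆ y, (d x y - (havg d)^[n] f y) := by
      change _ < hconj d ((havg d)^[n] f) x
      linarith
    obtain ⟨y, hy⟩ := exists_lt_of_lt_ciSup h3
    refine ⟨y, ?_⟩
    have a1 : hret d f x ≤ (havg d)^[n] f x := ciInf_le (iter_bdd self symm hf x) n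
    have a2 : hret d f y ≤ (havg d)^[n] f y := ciInf_le (iter_bdd self symm hf y) n
    linarith

theorem hret_lip [Nonempty Y] {f g : Y → ℝ} {c : ℝ} (self : ∀ x, d x x = 0)
    (symm : ∀ x y, d x y = d y x) (hf : ∀ x y, d x y ≤ f x + f y)
    (hg : ∀ x y, d x y ≤ g x + g y) (h : ∀ x, |f x - g x| ≤ c) (x : Y) :
    |hret d f x - hret d g x| ≤ c := by
  have h1 : ∀ n : ℕ, ∀ x, |(havg d)^[n] f x - (havg d)^[n] g x| ≤ c := by
    intro n
    induction n with
    | zero => exact h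
    | succ n ih =>
      intro x
      rw [Function.iterate_succ_apply', Function.iterate_succ_apply']
      exact havg_lip (iter_mem symm hf n) (iter_mem symm hg n) ih x
  exact le_of_tendsto' ((iter_tendsto self symm hf x).sub (iter_tendsto self symm hg x)).abs
    (fun n => h1 n x)

theorem hret_eq [Nonempty Y] (f : Hull d) : hret d f.1 = f.1 := by
  have h0 : havg d f.1 = f.1 := by
    funext x
    have h1 := hconj_le f.2.1 x
    have h2 : f.1 x ≤ hconj d f.1 x := by
      apply le_of_forall_pos_le_add
      intro ε hε
      obtain ⟨y, hy⟩ := f.2.2 x ε hε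
      have := le_hconj f.2.1 x y
      linarith
    unfold havg
    linarith
  funext x
  unfold hret
  have : ∀ n : ℕ, (havg d)^[n] f.1 = f.1 := fun n => Function.iterate_fixed h0 n
  simp [this]

theorem Hull.geodesic [Nonempty Y] (tri : ∀ x y z, d x z ≤ d x y + d y z)
    (self : ∀ x, d x x = 0) (symm : ∀ x y, d x y = d y x) :
    letI := Hull.metric tri
    IsGeodesicSpace (Hull d) := by
  letI := Hull.metric tri
  intro f g
  rcases eq_or_ne f g with rfl | hfg
  · refine ⟨fun _ => f, rfl, rfl, ?_⟩
    intro s hs t ht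
    rw [dist_self] at hs ht
    rw [dist_self, le_antisymm hs.2 hs.1, le_antisymm ht.2 ht.1]
    simp
  set L := dist f g with hL
  have hL0 : 0 < L := dist_pos.2 hfg
  have hdist : ∀ (a b : Hull d) x, |a.1 x - b.1 x| ≤ dist a b :=
    fun a b x => le_ciSup (Hull.bdd tri a b) x
  set l : ℝ → Y → ℝ := fun t x => f.1 x + (t / L) * (g.1 x - f.1 x) with hl
  have lmem : ∀ t ∈ Set.Icc (0 : ℝ) L, ∀ x y, d x y ≤ l t x + l t y := by
    intro t ht x y
    have h1 : 0 ≤ t / L := div_nonneg ht.1 hL0.le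
    have h2 : t / L ≤ 1 := (div_le_one hL0).2 ht.2
    have h3 := f.2.1 x y
    have h4 := g.2.1 x y
    simp only [hl]
    nlinarith
  have llip : ∀ s t x, |l s x - l t x| ≤ |s - t| := by
    intro s t x
    have e : l s x - l t x = (s - t) * ((g.1 x - f.1 x) / L) := by
      simp only [hl]; field_simp; ring
    rw [e, abs_mul, abs_div, abs_of_pos hL0]
    have h1 := hdist f g x
    rw [abs_sub_comm] at h1
    have h2 : |g.1 x - f.1 x| / L ≤ 1 := (div_le_one hL0).2 h1
    exact mul_le_of_le_one_right (abs_nonneg _) h2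
  classical
  set γ : ℝ → Hull d := fun t => if ht : t ∈ Set.Icc (0 : ℝ) L then
    ⟨hret d (l t), hret_mem self symm (lmem t ht)⟩ else f with hγ
  have γval : ∀ t ∈ Set.Icc (0 : ℝ) L, (γ t).1 = hret d (l t) := by
    intro t ht
    have : γ t = ⟨hret d (l t), hret_mem self symm (lmem t ht)⟩ := dif_pos ht
    rw [this]
  have γlip : ∀ s ∈ Set.Icc (0 : ℝ) L, ∀ t ∈ Set.Icc (0 : ℝ) L,
      dist (γ s) (γ t) ≤ |s - t| := by
    intro s hs t ht
    apply ciSup_le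
    intro x
    rw [γval s hs, γval t ht]
    exact hret_lip self symm (lmem s hs) (lmem t ht) (llip s t) x
  have m0 : (0 : ℝ) ∈ Set.Icc (0 : ℝ) L := ⟨le_rfl, hL0.le⟩
  have mL : L ∈ Set.Icc (0 : ℝ) L := ⟨hL0.le, le_rfl⟩
  have γ0 : γ 0 = f := by
    apply Subtype.ext
    have : l 0 = f.1 := by funext x; simp [hl]
    rw [γval _ m0, this]
    exact hret_eq f
  have γL : γ L = g := by
    apply Subtype.ext
    have : l L = g.1 := by funext x; simp [hl, div_self hL0.ne']
    rw [γval _ mL, this]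
    exact hret_eq g
  have main : ∀ s ∈ Set.Icc (0 : ℝ) L, ∀ t ∈ Set.Icc (0 : ℝ) L, s ≤ t → 
      dist (γ s) (γ t) = |s - t| := by
    intro s hs t ht hst
    apply le_antisymm (γlip s hs t ht)
    have h1 := γlip 0 m0 s hs
    have h2 := γlip t ht L mL
    rw [γ0, abs_of_nonpos (by linarith [hs.1])] at h1
    rw [γL, abs_of_nonpos (by linarith [ht.2])] at h2
    have h3 := dist_triangle4 f (γ s) (γ t) g
    rw [abs_of_nonpos (by linarith)]
    linarith
  refine ⟨γ, γ0, γL, ?_⟩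
  intro s hs t ht
  rcases le_total s t with h | h
  · exact main s hs t ht h
  · rw [dist_comm, abs_sub_comm]; exact main t ht s hs h

end Hull

/-- Exact version: `N` acts with zero displacement. -/
theorem noLox_quot {G : Type*} [Group G] (N : Subgroup G) [N.Normal] (hQ : PropertyNL (G ⧸ N))
    {Y : Type} [MulAction G Y] {d : Y → Y → ℝ} {δ : ℝ} (hδ : 0 ≤ δ) (H : HypPM G Y d δ)
    (hN : ∀ n ∈ N, ∀ y, d y (n • y) = 0) (h : G) (x : Y) {ε B : ℝ} (hε : 0 < ε)
    (hx : ∀ k : ℕ, ε * k - B ≤ d x (h ^ k • x)) : False := by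
  haveI : Nonempty Y := ⟨x⟩
  letI := Hull.metric H.tri
  -- action of `G` on the hull
  let act : G → Hull d → Hull d := fun g f => ⟨fun y => f.1 (g⁻¹ • y), by
    constructor
    · intro y z
      have := f.2.1 (g⁻¹ • y) (g⁻¹ • z)
      rwa [H.inv] at this
    · intro y ε hε
      obtain ⟨z, hz⟩ := f.2.2 (g⁻¹ • y) ε hε
      refine ⟨g • z, ?_⟩
      change f.1 (g⁻¹ • y) + f.1 (g⁻¹ • g • z) ≤ _
      rw [← H.inv g⁻¹ y (g • z), inv_smul_smul]
      exact hz⟩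
  have act_val : ∀ g f y, (act g f).1 y = f.1 (g⁻¹ • y) := fun _ _ _ => rfl
  have act_one : ∀ f, act 1 f = f := by
    intro f; apply Subtype.ext; funext y; simp [act_val]
  have act_mul : ∀ g g' f, act (g * g') f = act g (act g' f) := by
    intro g g' f; apply Subtype.ext; funext y; simp [act_val, mul_smul]
  have act_dist : ∀ g f f', dist (act g f) (act g f') = dist f f' := by
    intro g f f'
    exact Equiv.iSup_comp (g := fun y => |f.1 y - f'.1 y|) (MulAction.toPerm g⁻¹)
  have act_N : ∀ n ∈ N, ∀ f, act n f = f := by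
    intro n hn f
    apply Subtype.ext
    funext y
    rw [act_val]
    have h1 := f.lip H.tri y (n⁻¹ • y)
    have h2 := f.lip H.tri (n⁻¹ • y) y
    rw [hN _ (N.inv_mem hn)] at h1
    rw [H.symm, hN _ (N.inv_mem hn)] at h2
    linarith
  let a : G ⧸ N → Hull d → Hull d := fun q f => act q.out f
  have a_mk : ∀ (g : G) f, a (g : G ⧸ N) f = act g f := by
    intro g f
    obtain ⟨n, hn⟩ := QuotientGroup.mk_out_eq_mul N g
    change act (Quotient.out (g : G ⧸ N)) f = _
    rw [hn, act_mul, act_N _ n.2]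
  have ha : IsIsometricAction (G ⧸ N) (Hull d) a := by
    refine ⟨?_, ?_, ?_⟩
    · intro f
      rw [← QuotientGroup.mk_one, a_mk, act_one]
    · intro q q' f
      induction q using QuotientGroup.induction_on with | H g =>
      induction q' using QuotientGroup.induction_on with | H g' =>
      rw [← QuotientGroup.mk_mul, a_mk, a_mk, a_mk, act_mul]
    · intro q f f'
      exact act_dist _ _ _
  let i : Y → Hull d := fun y => ⟨fun z => d y z, by
    constructor
    · intro z w
      have := H.tri z y w
      rw [H.symm z y] at this
      exact this
    · intro z ε hε
      refine ⟨y, ?_⟩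
      change d y z + d y y ≤ _
      rw [H.self, H.symm z y]
      linarith⟩
  have i_act : ∀ g y, act g (i y) = i (g • y) := by
    intro g y
    apply Subtype.ext
    funext z
    change d y (g⁻¹ • z) = d (g • y) z
    rw [← H.inv g, smul_inv_smul]
  have i_dist : ∀ y z, dist (i y) (i z) = d y z := by
    intro y z
    apply le_antisymm
    · apply ciSup_le
      intro w
      change |d y w - d z w| ≤ d y z
      have h1 := H.tri y z w
      have h2 := H.tri z y w
      rw [H.symm z y] at h2
      rw [abs_le]; constructor <;> linarith
    · have h1 : |d y z - d z z| ≤ dist (i y) (i z) := le_ciSup (Hull.bdd H.tri (i y) (i z)) z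
      rw [H.self, sub_zero] at h1
      exact (le_abs_self _).trans h1
  obtain ⟨A, B, hA, hB, hAB⟩ := H.lox h x hε hx
  refine hQ (Hull d) (Hull.geodesic H.tri H.self H.symm)
    (Hull.hyperbolic H.tri H.symm hδ H.hyp) a ha (h : G ⧸ N) ⟨i x, A, B, hA, hB, ?_⟩
  intro m n
  rw [← QuotientGroup.mk_zpow, ← QuotientGroup.mk_zpow, a_mk, a_mk, i_act, i_act, i_dist]
  exact hAB m n

/-- Coarse version: `N` acts with bounded displacement. -/
theorem noLox_bdd {G : Type*} [Group G] (N : Subgroup G) [N.Normal] (hQ : PropertyNL (G ⧸ N))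
    {Y : Type} [MulAction G Y] {d : Y → Y → ℝ} {δ : ℝ} (hδ : 0 ≤ δ) (H : HypPM G Y d δ)
    {C : ℝ} (hN : ∀ n ∈ N, ∀ y, d y (n • y) ≤ C) (h : G) (x : Y) {ε B : ℝ} (hε : 0 < ε)
    (hx : ∀ k : ℕ, ε * k - B ≤ d x (h ^ k • x)) : False := by
  have hC : 0 ≤ C := by
    have := hN 1 N.one_mem x
    rwa [one_smul, H.self] at this
  let D : Y → Y → ℝ := fun y z => ⨅ n : N, d y ((n : G) • z)
  have bdd : ∀ y z, BddBelow (Set.range fun n : N => d y ((n : G) • z)) := by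
    intro y z
    refine ⟨0, ?_⟩
    rintro _ ⟨n, rfl⟩
    exact H.nonneg _ _
  have Dle : ∀ y z, ∀ n ∈ N, D y z ≤ d y (n • z) := fun y z n hn => ciInf_le (bdd y z) ⟨n, hn⟩
  have Dex : ∀ y z, ∀ η > 0, ∃ n ∈ N, d y (n • z) < D y z + η := by
    intro y z η hη
    have : (⨅ n : N, d y ((n : G) • z)) < D y z + η := by
      change D y z < _
      linarith
    obtain ⟨n, hn⟩ := exists_lt_of_ciInf_lt this
    exact ⟨n, n.2, hn⟩
  have Dled : ∀ y z, D y z ≤ d y z := by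
    intro y z
    have := Dle y z 1 N.one_mem
    rwa [one_smul] at this
  have dleD : ∀ y z, d y z ≤ D y z + C := by
    intro y z
    apply le_of_forall_pos_le_add
    intro η hη
    obtain ⟨n, hn, h1⟩ := Dex y z η hη
    have h2 := H.tri y (n • z) z
    rw [H.symm (n • z) z] at h2
    have := hN n hn z
    linarith
  have D0 : ∀ y z, 0 ≤ D y z := fun y z => le_ciInf fun n => H.nonneg _ _
  have Dsymm' : ∀ y z, D y z ≤ D z y := by
    intro y z
    apply le_of_forall_pos_le_add
    intro η hη
    obtain ⟨n, hn, h1⟩ := Dex z y η hη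
    have h2 := Dle y z n⁻¹ (N.inv_mem hn)
    rw [← H.inv n, smul_inv_smul, H.symm] at h2
    linarith
  have Dinv' : ∀ (g : G) y z, D (g • y) (g • z) ≤ D y z := by
    intro g y z
    apply le_of_forall_pos_le_add
    intro η hη
    obtain ⟨n, hn, h1⟩ := Dex y z η hη
    have h2 := Dle (g • y) (g • z) (g * n * g⁻¹) (Subgroup.Normal.conj_mem inferInstance n hn g)
    rw [mul_smul, inv_smul_smul, mul_smul, H.inv] at h2
    linarith
  have HD : HypPM G Y D (δ + C) := by
    refine ⟨?_, ?_, ?_, ?_, ?_⟩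
    · intro y
      apply le_antisymm _ (D0 y y)
      have := Dled y y
      rwa [H.self] at this
    · intro y z
      exact le_antisymm (Dsymm' y z) (Dsymm' z y)
    · intro y z w
      apply le_of_forall_pos_le_add
      intro η hη
      obtain ⟨n, hn, h1⟩ := Dex y z (η / 2) (by linarith)
      obtain ⟨m, hm, h2⟩ := Dex z w (η / 2) (by linarith)
      have h3 := Dle y w (n * m) (N.mul_mem hn hm)
      have h4 := H.tri y (n • z) ((n * m) • w)
      rw [mul_smul, H.inv] at h4
      rw [mul_smul] at h3
      linarith
    · intro g y z
      apply le_antisymm (Dinv' g y z)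
      have := Dinv' g⁻¹ (g • y) (g • z)
      rwa [inv_smul_smul, inv_smul_smul] at this
    · intro y z w v
      have h1 := H.hyp y z w v
      have := Dled y z
      have := Dled w v
      have := dleD y w
      have := dleD z v
      have := dleD y v
      have := dleD z w
      have m1 := le_max_left (D y w + D z v) (D y v + D z w)
      have m2 := le_max_right (D y w + D z v) (D y v + D z w)
      rcases max_cases (d y w + d z v) (d y v + d z w) with ⟨h4, _⟩ | ⟨h4, _⟩ <;>
        rw [h4] at h1 <;> linarith
  refine noLox_quot N hQ (by linarith) HD ?_ h x (B := B + C) hε ?_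
  · intro n hn y
    apply le_antisymm _ (D0 _ _)
    have := Dle y (n • y) n⁻¹ (N.inv_mem hn)
    rwa [inv_smul_smul, H.self] at this
  · intro k
    have := hx k
    have := dleD x (h ^ k • x)
    linarith

/-- In a subgroup without loxodromics, orbits converge to one point at infinity. -/
theorem orbit_conv {G Y : Type*} [Group G] [MulAction G Y] {d : Y → Y → ℝ} {δ : ℝ} (hδ : 0 ≤ δ)
    (H : HypPM G Y d δ) (N : Subgroup G)
    (hN : ∀ n ∈ N, ∀ x, d x (n ^ 2 • x) ≤ d x (n • x) + 2 * δ) (o : Y) (n m : G)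
    (hn : n ∈ N) (hm : m ∈ N) :
    d (n • o) (m • o) ≤ max (d o (n • o)) (d o (m • o)) + 8 * δ + 1 := by
  by_contra! hcon
  have l1 := le_max_left (d o (n • o)) (d o (m • o))
  have l2 := le_max_right (d o (n • o)) (d o (m • o))
  set M := max (d o (n • o)) (d o (m • o))
  have inv1 : ∀ g : G, d o (g⁻¹ • o) = d o (g • o) := by
    intro g
    rw [← H.inv g, smul_inv_smul, H.symm]
  have sq : ∀ g : G, d (g • o) (g⁻¹ • o) = d o (g ^ 2 • o) := by
    intro g
    rw [← H.inv g, smul_inv_smul, ← mul_smul, ← pow_two, H.symm]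
  have n2 := hN n hn o
  have m2 := hN m hm o
  have h1 := H.hyp (n • o) (m • o) o (n⁻¹ • o)
  rw [sq n, inv1 n, H.symm (n • o) o, H.symm (m • o) o] at h1
  have h1' : d (n • o) (m • o) - 2 * δ ≤ d (m • o) (n⁻¹ • o) := by
    rcases max_cases (d o (n • o) + d (m • o) (n⁻¹ • o)) (d o (n ^ 2 • o) + d o (m • o))
      with ⟨h4, _⟩ | ⟨h4, _⟩ <;> rw [h4] at h1 <;> linarith
  have h2 := H.hyp (m • o) (n⁻¹ • o) o (m⁻¹ • o)
  rw [sq m, inv1 m, H.symm (m • o) o, H.symm (n⁻¹ • o) o, inv1 n] at h2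
  have h2' : d (n • o) (m • o) - 4 * δ ≤ d (n⁻¹ • o) (m⁻¹ • o) := by
    rcases max_cases (d o (m • o) + d (n⁻¹ • o) (m⁻¹ • o)) (d o (m ^ 2 • o) + d o (n • o))
      with ⟨h4, _⟩ | ⟨h4, _⟩ <;> rw [h4] at h2 <;> linarith
  obtain ⟨h, hh⟩ : ∃ h, h = n⁻¹ * m := ⟨_, rfl⟩
  have hhN : h ∈ N := hh ▸ N.mul_mem (N.inv_mem hn) hm
  have h2N := hN h hhN o
  -- points of the broken path
  have e02 : d o (h • o) = d (n • o) (m • o) := by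
    rw [← H.inv n, hh, mul_smul, smul_inv_smul]
  have e01 : d o (n⁻¹ • o) = d o (n • o) := inv1 n
  have e12 : d (n⁻¹ • o) (h • o) = d o (m • o) := by
    rw [hh, mul_smul, H.inv]
  have e23 : d (h • o) ((h * n⁻¹) • o) = d o (n • o) := by
    rw [mul_smul, H.inv, inv1]
  have e13 : d (n⁻¹ • o) ((h * n⁻¹) • o) = d (n⁻¹ • o) (m⁻¹ • o) := by
    rw [hh, mul_assoc, mul_smul, H.inv, ← H.inv m⁻¹, mul_smul, inv_smul_smul, H.symm]
  have e34 : d ((h * n⁻¹) • o) (h ^ 2 • o) = d o (m • o) := by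
    rw [pow_two, mul_smul, mul_smul, H.inv, e12]
  have e24 : d (h • o) (h ^ 2 • o) = d (n • o) (m • o) := by
    rw [pow_two, mul_smul, H.inv, e02]
  have s1 := H.hyp o (h • o) (n⁻¹ • o) ((h * n⁻¹) • o)
  rw [e02, e13, e01, e23, H.symm (h • o) (n⁻¹ • o), e12] at s1
  have s2 := H.hyp o ((h * n⁻¹) • o) (h • o) (h ^ 2 • o)
  rw [e24, e02, e34, H.symm ((h * n⁻¹) • o) (h • o), e23] at s2
  rw [e02] at h2N
  have s1' : d (n • o) (m • o) + 2 * δ + 1 < d o ((h * n⁻¹) • o) := by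
    rcases max_cases (d o (n • o) + d o (n • o)) (d o ((h * n⁻¹) • o) + d o (m • o))
      with ⟨h4, _⟩ | ⟨h4, _⟩ <;> rw [h4] at s1 <;> linarith
  rcases max_cases (d (n • o) (m • o) + d o (m • o)) (d o (h ^ 2 • o) + d o (n • o))
      with ⟨h4, _⟩ | ⟨h4, _⟩ <;> rw [h4] at s2 <;> linarith

theorem exp_beats (A B a b c : ℝ) (hA : 1 ≤ A)
    (h : ∀ j : ℕ, (2 : ℝ) ^ j / A - B ≤ a + j * (b + c * j)) : False := by
  have t2 := tendsto_pow_const_div_const_pow_of_one_lt 2 (r := (2 : ℝ)) (by norm_num)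
  have t1 := tendsto_pow_const_div_const_pow_of_one_lt 1 (r := (2 : ℝ)) (by norm_num)
  have t0 := tendsto_pow_const_div_const_pow_of_one_lt 0 (r := (2 : ℝ)) (by norm_num)
  have t := ((t0.const_mul (a + B)).add (t1.const_mul b)).add (t2.const_mul c)
  simp only [mul_zero, add_zero] at t
  have hA' : 0 < 1 / A := by positivity
  obtain ⟨j, hj⟩ := (t.eventually (gt_mem_nhds hA')).exists
  have h1 := h j
  have h2 : (0 : ℝ) < 2 ^ j := by positivity
  have h3 := mul_lt_mul_of_pos_right hj h2
  have e : ((a + B) * ((j : ℝ) ^ 0 / 2 ^ j) + b * ((j : ℝ) ^ 1 / 2 ^ j) +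
    c * ((j : ℝ) ^ 2 / 2 ^ j)) * 2 ^ j = a + B + b * j + c * j ^ 2 := by
    field_simp
  rw [e] at h3
  have e2 : 1 / A * 2 ^ j = 2 ^ j / A := by ring
  rw [e2] at h3
  nlinarith

/-- The case of unbounded `N`-orbits. -/
theorem unbounded_case {G : Type*} [Group G] (N : Subgroup G) [N.Normal]
    (hQ : PropertyNL (G ⧸ N))
    {Y : Type} [MulAction G Y] {d : Y → Y → ℝ} {δ : ℝ} (hδ : 0 ≤ δ) (H : HypPM G Y d δ)
    (hNL : ∀ n ∈ N, ∀ x, ∀ ε > 0, ∀ B : ℝ, ¬ ∀ k : ℕ, ε * k - B ≤ d x (n ^ k • x)) (o : Y)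
    (hunb : ∀ R : ℝ, ∃ n ∈ N, R ≤ d o (n • o)) (g : G) (A B : ℝ) (hA : 1 ≤ A)
    (hg : ∀ k : ℕ, (k : ℝ) / A - B ≤ d o (g ^ k • o)) : False := by
  have hN2 : ∀ n ∈ N, ∀ x, d x (n ^ 2 • x) ≤ d x (n • x) + 2 * δ := by
    intro n hn x
    by_contra! hcon
    obtain ⟨ε, hε, h1⟩ := H.crit n x hcon
    exact hNL n hn x ε hε ε h1
  have conv := orbit_conv hδ H N hN2 o
  -- closeness of Busemann differences
  have close : ∀ x y p p' : Y, ∃ R : ℝ, ∀ n ∈ N, ∀ n' ∈ N, R ≤ d o (n • o) → R ≤ d o (n' • o) →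
      d x (n • p) - d y (n • p) ≤ d x (n' • p') - d y (n' • p') + 2 * δ := by
    intro x y p p'
    refine ⟨d x y + d o x + d o y + 2 * d o p + 2 * d o p' + 10 * δ + 2, ?_⟩
    intro n hn n' hn' h1 h2
    have h3 := H.hyp x (n • p) y (n' • p')
    have c1 := conv n n' hn hn'
    have a1 : d o (n • o) ≤ d o x + d x (n • p) + d o p := by
      have b1 := H.tri o x (n • o)
      have b2 := H.tri x (n • p) (n • o)
      rw [H.inv, H.symm p o] at b2
      linarith
    have a2 : d o (n' • o) ≤ d o y + d y (n' • p') + d o p' := by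
      have b1 := H.tri o y (n' • o)
      have b2 := H.tri y (n' • p') (n' • o)
      rw [H.inv, H.symm p' o] at b2
      linarith
    have a3 : d (n • p) (n' • p') ≤ d o p + d (n • o) (n' • o) + d o p' := by
      have b1 := H.tri (n • p) (n • o) (n' • p')
      have b2 := H.tri (n • o) (n' • o) (n' • p')
      rw [H.inv] at b1 b2
      rw [H.symm p o] at b1
      linarith
    have h4 := H.hyp x (n • p) y (n' • p')
    rw [H.symm y (n' • p')] at a2
    rw [H.symm (n • p) y, H.symm y (n' • p')] at h4
    rw [H.symm y (n' • p')]
    rcases max_cases (d o (n • o)) (d o (n' • o)) with ⟨h5, _⟩ | ⟨h5, _⟩ <;>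
    rw [h5] at c1 <;>
    rcases max_cases (d x y + d (n • p) (n' • p')) (d x (n' • p') + d y (n • p))
      with ⟨h6, _⟩ | ⟨h6, _⟩ <;> rw [h6] at h4 <;> linarith
  let P : Y → Y → Set ℝ := fun x y => {r | 0 ≤ r ∧ ∀ p, ∃ R : ℝ, ∀ n ∈ N, R ≤ d p (n • p) → 
    |d x (n • p) - d y (n • p)| ≤ r}
  let S : Y → Y → ℝ := fun x y => sInf (P x y)
  have Pbdd : ∀ x y, BddBelow (P x y) := fun x y => ⟨0, fun r hr => hr.1⟩
  have Pd : ∀ x y, d x y ∈ P x y := by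
    intro x y
    refine ⟨H.nonneg _ _, fun p => ⟨0, fun n hn _ => ?_⟩⟩
    have h1 := H.tri x y (n • p)
    have h2 := H.tri y x (n • p)
    rw [H.symm y x] at h2
    rw [abs_le]; constructor <;> linarith
  have Sle : ∀ x y r, r ∈ P x y → S x y ≤ r := fun x y r hr => csInf_le (Pbdd x y) hr
  have Sd : ∀ x y, S x y ≤ d x y := fun x y => Sle x y _ (Pd x y)
  have S0 : ∀ x y, 0 ≤ S x y := fun x y => le_csInf ⟨_, Pd x y⟩ fun r hr => hr.1
  -- change of base point for size
  have base : ∀ p (n : G), d o (n • o) ≤ 2 * d o p + d p (n • p) ∧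
      d p (n • p) ≤ 2 * d o p + d o (n • o) := by
    intro p n
    have b1 := H.tri o p (n • o)
    have b2 := H.tri p (n • p) (n • o)
    have b3 := H.tri p o (n • p)
    have b4 := H.tri o (n • o) (n • p)
    rw [H.inv] at b2 b4
    rw [H.symm p o] at b2 b3
    constructor <;> linarith
  have approx : ∀ x y, ∃ R : ℝ, ∀ n ∈ N, R ≤ d o (n • o) → 
      |S x y - (|d x (n • o) - d y (n • o)|)| ≤ 4 * δ := by
    intro x y
    obtain ⟨R1, hR1⟩ := close x y o o
    refine ⟨R1, fun n hn hnR => ?_⟩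
    rw [abs_le]
    constructor
    · have : |d x (n • o) - d y (n • o)| - 2 * δ ≤ S x y := by
        apply le_csInf ⟨_, Pd x y⟩
        rintro r ⟨hr0, hr⟩
        obtain ⟨R2, hR2⟩ := hr o
        obtain ⟨n', hn', h2⟩ := hunb (max R1 R2)
        have c1 := hR1 n hn n' hn' hnR ((le_max_left _ _).trans h2)
        have c2 := hR1 n' hn' n hn ((le_max_left _ _).trans h2) hnR
        have c3 := abs_le.1 (hR2 n' hn' ((le_max_right _ _).trans h2))
        have : |d x (n • o) - d y (n • o)| ≤ r + 2 * δ := by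
          rw [abs_le]; constructor <;> linarith
        linarith
      linarith
    · have : S x y ≤ |d x (n • o) - d y (n • o)| + 4 * δ := by
        apply Sle
        refine ⟨by positivity, fun p => ?_⟩
        obtain ⟨R2, hR2⟩ := close x y o p
        obtain ⟨R3, hR3⟩ := close x y p o
        obtain ⟨n', hn', h2⟩ := hunb (max R1 (max R2 R3))
        have q1 : R1 ≤ d o (n' • o) := (le_max_left _ _).trans h2
        have q2 : R2 ≤ d o (n' • o) := ((le_max_left _ _).trans (le_max_right _ _)).trans h2
        have q3 : R3 ≤ d o (n' • o) := ((le_max_right _ _).trans (le_max_right _ _)).trans h2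
        refine ⟨max R2 R3 + 2 * d o p, fun m hm hmR => ?_⟩
        have b := (base p m).2
        have m2 : R2 ≤ d o (m • o) := by
          have := le_max_left R2 R3
          linarith
        have m3 : R3 ≤ d o (m • o) := by
          have := le_max_right R2 R3
          linarith
        have c1 := hR1 n hn n' hn' hnR q1
        have c2 := hR1 n' hn' n hn q1 hnR
        have c3 := hR2 n' hn' m hm q2 m2
        have c4 := hR3 m hm n' hn' m3 q3
        have c5 := neg_abs_le (d x (n • o) - d y (n • o))
        have c6 := le_abs_self (d x (n • o) - d y (n • o))
        rw [abs_le]; constructor <;> linarith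
      linarith
  have Psymm : ∀ x y, P x y = P y x := by
    intro x y
    ext r
    simp only [P, Set.mem_setOf_eq, abs_sub_comm]
  have Pinv' : ∀ (h : G) x y, P x y ⊆ P (h • x) (h • y) := by
    rintro h x y r ⟨hr0, hr⟩
    refine ⟨hr0, fun p => ?_⟩
    obtain ⟨R, hR⟩ := hr (h⁻¹ • p)
    refine ⟨R, fun n hn hnR => ?_⟩
    have e : ∀ z, d (h • z) (n • p) = d z ((h⁻¹ * n * h) • h⁻¹ • p) := by
      intro z
      rw [← H.inv h z, mul_smul, smul_inv_smul, mul_smul, smul_inv_smul]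
    rw [e, e]
    have hc : h⁻¹ * n * h ∈ N := by
      have := Subgroup.Normal.conj_mem (inferInstance : N.Normal) n hn h⁻¹
      rwa [inv_inv] at this
    apply hR _ hc
    rw [← e, smul_inv_smul]
    exact hnR
  have Pinv : ∀ (h : G) x y, P (h • x) (h • y) = P x y := by
    intro h x y
    apply Set.Subset.antisymm _ (Pinv' h x y)
    have := Pinv' h⁻¹ (h • x) (h • y)
    rwa [inv_smul_smul, inv_smul_smul] at this
  have HS : HypPM G Y S (8 * δ) := by
    refine ⟨?_, ?_, ?_, ?_, ?_⟩
    · intro x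
      apply le_antisymm _ (S0 x x)
      have := Sd x x
      rwa [H.self] at this
    · intro x y
      change sInf (P x y) = sInf (P y x)
      rw [Psymm]
    · intro x y z
      apply le_of_forall_pos_le_add
      intro η hη
      obtain ⟨r, hr, h1⟩ := exists_lt_of_csInf_lt ⟨_, Pd x y⟩
        (show sInf (P x y) < S x y + η / 2 by change S x y < _; linarith)
      obtain ⟨s, hs, h2⟩ := exists_lt_of_csInf_lt ⟨_, Pd y z⟩
        (show sInf (P y z) < S y z + η / 2 by change S y z < _; linarith)
      have h3 : S x z ≤ r + s := by
        apply Sle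
        refine ⟨add_nonneg hr.1 hs.1, fun p => ?_⟩
        obtain ⟨R1, hR1⟩ := hr.2 p
        obtain ⟨R2, hR2⟩ := hs.2 p
        refine ⟨max R1 R2, fun n hn hnR => ?_⟩
        exact (abs_sub_le _ (d y (n • p)) _).trans
          (add_le_add (hR1 n hn ((le_max_left _ _).trans hnR))
            (hR2 n hn ((le_max_right _ _).trans hnR)))
      linarith
    · intro h x y
      change sInf (P (h • x) (h • y)) = sInf (P x y)
      rw [Pinv]
    · intro x y z w
      obtain ⟨R1, h1⟩ := approx x y
      obtain ⟨R2, h2⟩ := approx z w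
      obtain ⟨R3, h3⟩ := approx x z
      obtain ⟨R4, h4⟩ := approx y w
      obtain ⟨R5, h5⟩ := approx x w
      obtain ⟨R6, h6⟩ := approx y z
      obtain ⟨n, hn, hR⟩ := hunb (max R1 (max R2 (max R3 (max R4 (max R5 R6)))))
      simp only [max_le_iff] at hR
      obtain ⟨r1, r2, r3, r4, r5, r6⟩ := hR
      have k1 := abs_le.1 (h1 n hn r1)
      have k2 := abs_le.1 (h2 n hn r2)
      have k3 := abs_le.1 (h3 n hn r3)
      have k4 := abs_le.1 (h4 n hn r4)
      have k5 := abs_le.1 (h5 n hn r5)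
      have k6 := abs_le.1 (h6 n hn r6)
      have real4 : ∀ a b c e : ℝ, |a - b| + |c - e| ≤
          max (|a - c| + |b - e|) (|a - e| + |b - c|) := by
        intro a b c e
        rw [le_max_iff]
        by_contra! hcon
        obtain ⟨u1, u2⟩ := hcon
        rcases abs_cases (a - b) with ⟨v1, _⟩ | ⟨v1, _⟩ <;>
        rcases abs_cases (c - e) with ⟨v2, _⟩ | ⟨v2, _⟩ <;>
        linarith [le_abs_self (a - c), neg_abs_le (a - c), le_abs_self (b - e),
          neg_abs_le (b - e), le_abs_self (a - e), neg_abs_le (a - e),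
          le_abs_self (b - c), neg_abs_le (b - c)]
      have k := real4 (d x (n • o)) (d y (n • o)) (d z (n • o)) (d w (n • o))
      have m1 := le_max_left (S x z + S y w) (S x w + S y z)
      have m2 := le_max_right (S x z + S y w) (S x w + S y z)
      rcases le_max_iff.1 k with k | k <;> linarith
  -- bounded displacement of N
  have SN : ∀ m ∈ N, ∀ x, S x (m • x) ≤ 30 * δ := by
    intro m hm x
    by_contra! hcon
    have hlow : 2 * S x (m • x) - 14 * δ ≤ S x (m ^ 2 • x) := by
      obtain ⟨R1, h1⟩ := approx x (m • x)
      obtain ⟨R2, h2⟩ := approx x (m ^ 2 • x)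
      obtain ⟨R3, h3⟩ := close x (m • x) o o
      obtain ⟨n, hn, hR⟩ := hunb (max R1 (max R2 (R3 + d o (m • o) + |R3|)))
      simp only [max_le_iff] at hR
      obtain ⟨r1, r2, r3⟩ := hR
      have k1 := abs_le.1 (h1 n hn r1)
      have k2 := abs_le.1 (h2 n hn r2)
      have hmn : m⁻¹ * n ∈ N := N.mul_mem (N.inv_mem hm) hn
      have r3' : R3 ≤ d o (n • o) := by
        have := H.nonneg o (m • o)
        have := abs_nonneg R3
        linarith
      have r3'' : R3 ≤ d o ((m⁻¹ * n) • o) := by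
        rw [mul_smul, ← H.inv m, smul_inv_smul]
        have := H.tri o (m • o) (n • o)
        have := abs_nonneg R3
        linarith
      have c1 := h3 n hn _ hmn r3' r3''
      have c2 := h3 _ hmn n hn r3'' r3'
      have e1 : d x ((m⁻¹ * n) • o) = d (m • x) (n • o) := by
        rw [mul_smul, ← H.inv m, smul_inv_smul]
      have e2 : d (m • x) ((m⁻¹ * n) • o) = d (m ^ 2 • x) (n • o) := by
        rw [mul_smul, ← H.inv m, smul_inv_smul, pow_two, mul_smul]
      rw [e1, e2] at c1 c2
      have l1 := le_abs_self (d x (n • o) - d (m ^ 2 • x) (n • o))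
      have l2 := neg_abs_le (d x (n • o) - d (m ^ 2 • x) (n • o))
      rcases abs_cases (d x (n • o) - d (m • x) (n • o)) with ⟨v1, _⟩ | ⟨v1, _⟩ <;>
        rw [v1] at k1 <;> linarith
    obtain ⟨ε, hε, h1⟩ := HS.crit m x (by linarith)
    exact hNL m hm x ε hε ε fun k => (h1 k).trans (Sd _ _)
  -- growth along g
  have Sg : ∀ k : ℕ, d o (g ^ (2 * k) • o) ≤ d o (g ^ k • o) + S o (g ^ k • o) + 6 * δ := by
    intro k
    set h := g ^ k with hh
    have e0 : g ^ (2 * k) = h * h := by rw [hh, ← pow_add, two_mul]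
    obtain ⟨R1, h1⟩ := approx o (h • o)
    obtain ⟨R2, h2⟩ := approx o (h⁻¹ • o)
    obtain ⟨n, hn, hR⟩ := hunb (max R1 R2)
    have k1 := abs_le.1 (h1 n hn ((le_max_left _ _).trans hR))
    have k2 := abs_le.1 (h2 n hn ((le_max_right _ _).trans hR))
    have h3 := H.hyp (h⁻¹ • o) (h • o) o (n • o)
    have e1 : d (h⁻¹ • o) (h • o) = d o ((h * h) • o) := by
      rw [← H.inv h, smul_inv_smul, mul_smul]
    have e2 : d (h⁻¹ • o) o = d o (h • o) := by
      rw [← H.inv h, smul_inv_smul]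
    have e3 : S o (h⁻¹ • o) = S o (h • o) := by
      rw [← HS.inv h, smul_inv_smul, HS.symm]
    rw [e1, e2, H.symm (h • o) o] at h3
    rw [e3] at k2
    rw [e0]
    have l1 := neg_abs_le (d o (n • o) - d (h • o) (n • o))
    have l2 := neg_abs_le (d o (n • o) - d (h⁻¹ • o) (n • o))
    rcases max_cases (d o (h • o) + d (h • o) (n • o)) (d (h⁻¹ • o) (n • o) + d o (h • o))
      with ⟨h6, _⟩ | ⟨h6, _⟩ <;> rw [h6] at h3 <;> linarith
  have hex : ∃ j : ℕ, S o (g ^ (2 ^ j) • o) + 2 * (8 * δ) < S o ((g ^ (2 ^ j)) ^ 2 • o) := by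
    by_contra! hcon
    have b1 : ∀ j : ℕ, S o (g ^ (2 ^ j) • o) ≤ S o (g • o) + 16 * δ * j := by
      intro j
      induction j with
      | zero => simp
      | succ j ih =>
        have := hcon j
        rw [← pow_mul, ← pow_succ] at this
        push_cast
        linarith
    have b2 : ∀ j : ℕ, d o (g ^ (2 ^ j) • o) ≤
        d o (g • o) + j * ((S o (g • o) + 6 * δ) + 16 * δ * j) := by
      intro j
      induction j with
      | zero => simp
      | succ j ih =>
        have h1 := Sg (2 ^ j)
        rw [← pow_succ'] at h1
        have h2 := b1 j
        have : (0 : ℝ) ≤ j := Nat.cast_nonneg _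
        push_cast
        nlinarith
    refine exp_beats A B _ _ _ hA fun j => le_trans ?_ (b2 j)
    have := hg (2 ^ j)
    push_cast at this
    exact this
  obtain ⟨j, hj⟩ := hex
  obtain ⟨ε, hε, h1⟩ := HS.crit _ o hj
  exact noLox_bdd N hQ (by linarith) HS SN _ o hε h1

/-- Property (NL) is preserved under extensions. -/
theorem propertyNL_extension {G : Type*} [Group G] (N : Subgroup G) [N.Normal]
    (hN : PropertyNL N) (hQ : PropertyNL (G ⧸ N)) : PropertyNL G := by
  intro X _ hgeo hhyp a ha g hlox
  obtain ⟨a1, a2, a3⟩ := ha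
  letI : MulAction G X :=
    { smul := a
      one_smul := a1
      mul_smul := a2 }
  have asm : ∀ (h : G) (x : X), a h x = h • x := fun _ _ => rfl
  obtain ⟨δ, hδ, hyp⟩ := hhyp
  have H : HypPM G X dist δ := ⟨dist_self, dist_comm, dist_triangle, a3, hyp⟩
  have hNL : ∀ n ∈ N, ∀ x : X, ∀ ε > 0, ∀ B : ℝ,
      ¬ ∀ k : ℕ, ε * k - B ≤ dist x (n ^ k • x) := by
    intro n hn x ε hε B hx
    obtain ⟨A, B', hA, hB, hAB⟩ := H.lox n x hε hx
    refine hN X hgeo ⟨δ, hδ, hyp⟩ (fun m x => a m x)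
      ⟨fun x => a1 x, fun g h x => a2 g h x, fun g => a3 g⟩ ⟨n, hn⟩ ⟨x, A, B', hA, hB, ?_⟩
    intro p q
    exact hAB p q
  obtain ⟨o, A, B, hA, hB, hAB⟩ := hlox
  have hg : ∀ k : ℕ, (k : ℝ) / A - B ≤ dist o (g ^ k • o) := by
    intro k
    have := (hAB 0 k).1
    rw [zpow_zero, a1, zpow_natCast, asm] at this
    simpa using this
  by_cases hunb : ∀ R : ℝ, ∃ n ∈ N, R ≤ dist o (n • o)
  · exact unbounded_case N hQ hδ H hNL o hunb g A B hA hg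
  · push Not at hunb
    obtain ⟨C, hC⟩ := hunb
    have HY : HypPM G (MulAction.orbit G o) (fun x y => dist (x : X) (y : X)) δ :=
      ⟨fun x => dist_self _, fun x y => dist_comm _ _, fun x y z => dist_triangle _ _ _,
        fun h x y => a3 h x y, fun x y z w => hyp x y z w⟩
    refine noLox_bdd N hQ hδ HY (C := C) ?_ g ⟨o, MulAction.mem_orbit_self o⟩
      (ε := 1 / A) (B := B) (by positivity) ?_
    · rintro n hn ⟨_, h, rfl⟩
      change dist (h • o) (n • h • o) ≤ C
      have e : n • h • o = h • (h⁻¹ * n * h) • o := by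
        simp only [← mul_smul]
        congr 1
        group
      rw [e, H.inv]
      have := Subgroup.Normal.conj_mem (inferInstance : N.Normal) n hn h⁻¹
      rw [inv_inv] at this
      exact (hC _ this).le
    · intro k
      have := hg k
      rw [div_mul_eq_mul_div, one_mul]
      exact this
end

section
/- Let X be an infinite compact Hausdorff topological space and let 𝓘 be a basis for the topology of X consisting of nonempty open sets that are not dense in X. Then there exists a finite subset 𝓐 ⊆ 𝓘 which covers X and such that for every I, J ∈ 𝓐 there exists K ∈ 𝓐 whose closure is disjoint from closure(I) ∪ closure(J). -/
/-- In an infinite compact Hausdorff space with a basis `𝓘` of nonempty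
non-dense open sets, there is a finite subcover `𝓐 ⊆ 𝓘` such that any two
members of `𝓐` admit a third member whose closure avoids both their closures. -/
theorem exists_finite_separating_subcover {X : Type*} [TopologicalSpace X]
    [CompactSpace X] [T2Space X] [Infinite X] (𝓘 : Set (Set X))
    (hbasis : TopologicalSpace.IsTopologicalBasis 𝓘)
    (hne : ∀ I ∈ 𝓘, I.Nonempty)
    (hnd : ∀ I ∈ 𝓘, ¬ Dense I) :
    ∃ 𝓐 : Finset (Set X), ↑𝓐 ⊆ 𝓘 ∧ (∀ x : X, ∃ I ∈ 𝓐, x ∈ I) ∧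
      ∀ I ∈ 𝓐, ∀ J ∈ 𝓐, ∃ K ∈ 𝓐,
        closure K ∩ (closure I ∪ closure J) = (∅ : Set X) := by
  classical
  let p : Fin 3 → X := fun i => Infinite.natEmbedding X i
  have hp : Function.Injective p := fun i j h =>
    Fin.ext ((Infinite.natEmbedding X).injective h)
  obtain ⟨U, hU, hdis⟩ := (Set.finite_range p).t2_separation
  have hK : ∀ i, ∃ K ∈ 𝓘, p i ∈ K ∧ closure K ⊆ U (p i) := fun i =>
    hbasis.exists_closure_subset ((hU (p i)).2.mem_nhds (hU (p i)).1)
  choose K hKI hpK hKU using hK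
  have hd : ∀ i j, i ≠ j → Disjoint (closure (K i)) (closure (K j)) := fun i j hij =>
    (hdis (Set.mem_range_self i) (Set.mem_range_self j) (fun h => hij (hp h))).mono
      (hKU i) (hKU j)
  have hV : ∀ x : X, ∃ V ∈ 𝓘, x ∈ V ∧
      ∃ i₀, ∀ i, i ≠ i₀ → Disjoint (closure (K i)) (closure V) := by
    intro x
    have h1 : ∃ i₀, ∀ i, i ≠ i₀ → x ∉ closure (K i) := by
      by_cases h : ∃ i, x ∈ closure (K i)
      · obtain ⟨i₀, h0⟩ := h
        exact ⟨i₀, fun i hi hx => Set.disjoint_left.1 (hd i i₀ hi) hx h0⟩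
      · exact ⟨0, fun i _ hx => h ⟨i, hx⟩⟩
    obtain ⟨i₀, h0⟩ := h1
    have ho : IsOpen (⋂ i, ⋂ (_ : i ≠ i₀), (closure (K i))ᶜ) :=
      isOpen_iInter_of_finite fun i => isOpen_iInter_of_finite fun _ =>
        isClosed_closure.isOpen_compl
    obtain ⟨V, hVI, hxV, hVs⟩ := hbasis.exists_closure_subset
      (ho.mem_nhds (x := x) (by simpa using h0))
    refine ⟨V, hVI, hxV, i₀, fun i hi => Set.disjoint_right.2 fun y hy => ?_⟩
    have := hVs hy
    simp only [Set.mem_iInter] at this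
    exact this i hi
  choose V hVI hxV hVd using hV
  obtain ⟨t, ht⟩ := CompactSpace.elim_nhds_subcover V
    (fun x => (hbasis.isOpen (hVI x)).mem_nhds (hxV x))
  have key : ∀ I ∈ t.image V ∪ Finset.univ.image K,
      ∃ i₀, ∀ i, i ≠ i₀ → Disjoint (closure (K i)) (closure I) := by
    intro I hI
    simp only [Finset.mem_union, Finset.mem_image, Finset.mem_univ, true_and] at hI
    rcases hI with ⟨x, _, rfl⟩ | ⟨j, rfl⟩
    · exact hVd x
    · exact ⟨j, fun i hi => hd i j hi⟩
  refine ⟨t.image V ∪ Finset.univ.image K, ?_, ?_, ?_⟩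
  · intro I hI
    simp only [Finset.mem_coe, Finset.mem_union, Finset.mem_image, Finset.mem_univ,
      true_and] at hI
    rcases hI with ⟨x, _, rfl⟩ | ⟨j, rfl⟩
    · exact hVI x
    · exact hKI j
  · intro x
    have hx : x ∈ ⋃ y ∈ t, V y := by rw [ht]; trivial
    simp only [Set.mem_iUnion] at hx
    obtain ⟨y, hy, hxy⟩ := hx
    exact ⟨V y, Finset.mem_union_left _ (Finset.mem_image_of_mem V hy), hxy⟩
  · intro I hI J hJ
    obtain ⟨a, ha⟩ := key I hI
    obtain ⟨b, hb⟩ := key J hJ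
    have h3 : ∀ a b : Fin 3, ∃ i, i ≠ a ∧ i ≠ b := by decide
    obtain ⟨i, hia, hib⟩ := h3 a b
    refine ⟨K i, Finset.mem_union_right _ (Finset.mem_image_of_mem K (Finset.mem_univ i)), ?_⟩
    exact Set.disjoint_iff_inter_eq_empty.1
      (Set.disjoint_union_right.2 ⟨ha i hia, hb i hib⟩)
end

section
/- Let X be an infinite compact Hausdorff space and G a group acting faithfully on X by homeomorphisms. Let 𝓘 be a basis for the topology of X consisting of nonempty open sets that are not dense in X, and suppose conditions (2T) and (L) hold for (G, X, 𝓘). Let 𝓐 ⊆ 𝓘 be a finite cover of X such that for every I, J ∈ 𝓐 there exists K ∈ 𝓐 with closure(K) ∩ (closure(I) ∪ closure(J)) = ∅, and let A := {g ∈ G : there exists I ∈ 𝓐 with g•x = x for all x ∈ I}. Then every element of G is a product of at most 3 elements of A. -/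
/-- An action of `G` on `X` by homeomorphisms. -/
def IsActionByHomeos (G : Type*) [Group G] (X : Type*) [TopologicalSpace X]
    (a : G → X → X) : Prop :=
  (∀ x, a 1 x = x) ∧ (∀ g h x, a (g * h) x = a g (a h x)) ∧
    (∀ g : G, Continuous (a g))

/-- The action is faithful. -/
def FaithfulAction (G : Type*) [Group G] (X : Type*) (a : G → X → X) : Prop :=
  ∀ g : G, (∀ x, a g x = x) → g = 1

/-- `(I, J) ∈ 𝓘⁽²⁾`: a pair of members of `𝓘` with disjoint closures whose
union is not dense. -/
def Tup2 {X : Type*} [TopologicalSpace X] (𝓘 : Set (Set X))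
    (I J : Set X) : Prop :=
  I ∈ 𝓘 ∧ J ∈ 𝓘 ∧ Disjoint (closure I) (closure J) ∧ ¬ Dense (I ∪ J)

/-- `(I, J, K) ∈ 𝓘⁽³⁾`: a triple of members of `𝓘` with pairwise disjoint
closures whose union is not dense. -/
def Tup3 {X : Type*} [TopologicalSpace X] (𝓘 : Set (Set X))
    (I J K : Set X) : Prop :=
  I ∈ 𝓘 ∧ J ∈ 𝓘 ∧ K ∈ 𝓘 ∧ Disjoint (closure I) (closure J) ∧
    Disjoint (closure I) (closure K) ∧ Disjoint (closure J) (closure K) ∧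
    ¬ Dense (I ∪ J ∪ K)

/-- Condition (C): every member of `𝓘` has its complement contained in a
member of `𝓘`. -/
def CondC {X : Type*} (𝓘 : Set (Set X)) : Prop :=
  ∀ I ∈ 𝓘, ∃ J ∈ 𝓘, Iᶜ ⊆ J

/-- Condition (2T): `G` preserves `𝓘` and acts doubly transitively on it. -/
def Cond2T {G X : Type*} [Group G] [TopologicalSpace X] (a : G → X → X)
    (𝓘 : Set (Set X)) : Prop :=
  (∀ g : G, ∀ I ∈ 𝓘, a g '' I ∈ 𝓘) ∧
    ∀ I J I' J' : Set X, Tup2 𝓘 I J → Tup2 𝓘 I' J' →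
      ∃ g : G, a g '' I = I' ∧ a g '' J = J'

/-- Condition (3T): weak triple transitivity. -/
def Cond3T {G X : Type*} [Group G] [TopologicalSpace X] (a : G → X → X)
    (𝓘 : Set (Set X)) : Prop :=
  ∀ g h : G, ∃ M N P : Set X, Tup3 𝓘 M N P ∧
    ∃ b : G, a b '' (a g '' M) = M ∧ a b '' (a h '' N) = N ∧ a b '' P = P

/-- Condition (L): local actions on disjoint members of `𝓘` can be combined. -/
def CondL {G X : Type*} [Group G] [TopologicalSpace X] (a : G → X → X)
    (𝓘 : Set (Set X)) : Prop :=
  ∀ I J K : Set X, Tup3 𝓘 I J K → ∀ g h : G, a g '' I = I → a h '' J = J →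
    ∃ b : G, (∀ x ∈ I, a b x = a g x) ∧ (∀ x ∈ J, a b x = a h x) ∧
      (∀ x ∈ K, a b x = x)

/-- There are no isolated points. -/
theorem no_isolated {G X : Type*} [Group G] [TopologicalSpace X]
    [CompactSpace X] [T2Space X] [Infinite X]
    (a : G → X → X) (𝓘 : Set (Set X)) (hbasis : TopologicalSpace.IsTopologicalBasis 𝓘)
    (hne : ∀ I ∈ 𝓘, I.Nonempty)
    (h2T : Cond2T a 𝓘) (x : X) : ¬ IsOpen ({x} : Set X) := by
  intro hx
  obtain ⟨y, hy⟩ : ∃ y : X, ¬ IsOpen ({y} : Set X) := by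
    by_contra! h
    have : DiscreteTopology X := discreteTopology_iff_isOpen_singleton.2 h
    exact not_finite_iff_infinite.2 ‹Infinite X› (finite_of_compact_of_discrete)
  have hyx : y ≠ x := by rintro rfl; exact hy hx
  obtain ⟨z, hz⟩ := (Set.toFinite ({x, y} : Set X)).exists_notMem
  have hzx : z ≠ x := by rintro rfl; simp at hz
  have hzy : z ≠ y := by rintro rfl; simp at hz
  have hxI : ({x} : Set X) ∈ 𝓘 := by
    obtain ⟨v, hv, hxv, hvs⟩ := hbasis.exists_subset_of_mem_open (Set.mem_singleton x) hx
    have : v = {x} := Set.Subset.antisymm hvs (by simpa using hxv)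
    exact this ▸ hv
  obtain ⟨N, hN, hyN, hNs⟩ := hbasis.exists_closure_subset
    (IsOpen.mem_nhds ((Set.toFinite {x, z}).isClosed.isOpen_compl (X := X))
      (show y ∈ ({x, z} : Set X)ᶜ by simp [hyx, Ne.symm hzy]))
  have hxN : x ∉ closure N := fun h => by simpa using hNs h
  have hzN : z ∉ closure N := fun h => by simpa using hNs h
  have hnd : ¬ Dense (N ∪ {x}) := by
    intro hd
    have := hd z
    rw [closure_union, closure_singleton] at this
    rcases this with h | h
    · exact hzN h
    · exact hzx h
  have hdis : Disjoint (closure N) (closure {x}) := by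
    rw [closure_singleton, Set.disjoint_singleton_right]; exact hxN
  obtain ⟨g, -, h⟩ := h2T.2 N {x} {x} N ⟨hN, hxI, hdis, hnd⟩
    ⟨hxI, hN, hdis.symm, by rwa [Set.union_comm]⟩
  rw [Set.image_singleton] at h
  apply hy
  have hNo := hbasis.isOpen hN
  rw [← h] at hNo hyN
  rw [Set.mem_singleton_iff.1 hyN]
  exact hNo

theorem exists_third {G X : Type*} [Group G] [TopologicalSpace X]
    [CompactSpace X] [T2Space X] [Infinite X]
    (a : G → X → X) (𝓘 : Set (Set X)) (hbasis : TopologicalSpace.IsTopologicalBasis 𝓘)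
    (hne : ∀ I ∈ 𝓘, I.Nonempty)
    (h2T : Cond2T a 𝓘) (I K L : Set X) (hI : I ∈ 𝓘) (hK : K ∈ 𝓘) (hL : L ∈ 𝓘)
    (hIK : Disjoint (closure I) (closure K))
    (hLL : closure L ∩ (closure I ∪ closure K) = ∅) : ∃ P, Tup3 𝓘 I K P := by
  obtain ⟨p, hp⟩ := hne L hL
  obtain ⟨q, hq, hqp⟩ : ∃ q ∈ L, q ≠ p := by
    by_contra! h
    have : L = {p} := Set.eq_singleton_iff_unique_mem.2 ⟨hp, h⟩
    exact no_isolated a 𝓘 hbasis hne h2T p (this ▸ hbasis.isOpen hL)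
  obtain ⟨P, hP, hpP, hPs⟩ := hbasis.exists_closure_subset
    (IsOpen.mem_nhds ((hbasis.isOpen hL).inter (isOpen_compl_singleton (x := q)))
      (show p ∈ L ∩ {q}ᶜ from ⟨hp, by simpa using hqp.symm⟩))
  have key : ∀ x ∈ L, x ∉ closure I ∧ x ∉ closure K := by
    intro x hx
    have : x ∉ closure L ∩ (closure I ∪ closure K) := by rw [hLL]; simp
    have h2 := subset_closure hx
    simp only [Set.mem_inter_iff, Set.mem_union] at this
    tauto
  refine ⟨P, hI, hK, hP, hIK, ?_, ?_, ?_⟩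
  · exact Set.disjoint_right.2 fun x hx => (key x (hPs hx).1).1
  · exact Set.disjoint_right.2 fun x hx => (key x (hPs hx).1).2
  · intro hd
    have := hd q
    rw [closure_union, closure_union] at this
    rcases this with (h | h) | h
    · exact (key q hq).1 h
    · exact (key q hq).2 h
    · exact (hPs h).2 rfl

theorem extend_by_id {G X : Type*} [Group G] [TopologicalSpace X]
    (a : G → X → X) (hact : IsActionByHomeos G X a)
    (𝓘 : Set (Set X)) (h2T : Cond2T a 𝓘) (hL : CondL a 𝓘)
    (I K P : Set X) (hT : Tup3 𝓘 I K P) (f : G) (hf : Tup2 𝓘 (a f '' I) K) :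
    ∃ d : G, (∀ x ∈ I, a d x = a f x) ∧ ∀ x ∈ K, a d x = x := by
  obtain ⟨h1, hmul, -⟩ := hact
  have himg : ∀ g h (S : Set X), a (g * h) '' S = a g '' (a h '' S) := by
    intro g h S
    rw [Set.image_image]
    exact Set.image_congr fun x _ => hmul g h x
  have hcan : ∀ g (S : Set X), a g⁻¹ '' (a g '' S) = S := by
    intro g S
    rw [← himg, inv_mul_cancel]
    simp [h1]
  have hIK : Tup2 𝓘 I K := by
    obtain ⟨hI, hK, hP, h1, h2, h3, h4⟩ := hT
    exact ⟨hI, hK, h1, fun hd => h4 (hd.mono Set.subset_union_left)⟩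
  obtain ⟨d, hdI, hdK⟩ := h2T.2 _ _ _ _ hIK hf
  obtain ⟨b, hbI, hbK, -⟩ := hL I K P hT (d⁻¹ * f) d⁻¹
    (by rw [himg, ← hdI, hcan]) (by conv_lhs => rw [← hdK, hcan])
  refine ⟨d * b, fun x hx => ?_, fun x hx => ?_⟩
  · rw [hmul, hbI x hx, ← hmul, mul_inv_cancel_left]
  · rw [hmul, hbK x hx, ← hmul, mul_inv_cancel, h1]

/-- Property (1): `G` is boundedly generated by `A`; in fact every element is a
product of at most `3` elements of `A`. -/
theorem bounded_generation {G X : Type*} [Group G] [TopologicalSpace X]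
    [CompactSpace X] [T2Space X] [Infinite X]
    (a : G → X → X) (hact : IsActionByHomeos G X a)
    (hfaith : FaithfulAction G X a)
    (𝓘 : Set (Set X)) (hbasis : TopologicalSpace.IsTopologicalBasis 𝓘)
    (hne : ∀ I ∈ 𝓘, I.Nonempty) (hnd : ∀ I ∈ 𝓘, ¬ Dense I)
    (h2T : Cond2T a 𝓘) (hL : CondL a 𝓘)
    (𝓐 : Finset (Set X)) (h𝓐sub : ↑𝓐 ⊆ 𝓘)
    (h𝓐cover : ∀ x : X, ∃ I ∈ 𝓐, x ∈ I)
    (h𝓐sep : ∀ I ∈ 𝓐, ∀ J ∈ 𝓐, ∃ K ∈ 𝓐,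
      closure K ∩ (closure I ∪ closure J) = (∅ : Set X)) :
    ∀ g : G, ∃ l : List G, l.length ≤ 3 ∧
      (∀ y ∈ l, ∃ I ∈ 𝓐, ∀ x ∈ I, a y x = x) ∧ l.prod = g := by
  intro g
  have hact' := hact
  obtain ⟨h1, hmul, hcont⟩ := hact'
  have hX : Nonempty X := inferInstance
  obtain ⟨x⟩ := hX
  obtain ⟨I, hI, hxI⟩ := h𝓐cover x
  obtain ⟨J, hJ, hxJ⟩ := h𝓐cover (a g x)
  obtain ⟨K, hK, hKs⟩ := h𝓐sep I hI J hJ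
  obtain ⟨L, hLA, hLs⟩ := h𝓐sep I hI K hK
  have himem : ∀ {S}, S ∈ 𝓐 → S ∈ 𝓘 := fun h => h𝓐sub h
  have hKd : Disjoint (closure K) (closure I ∪ closure J) :=
    Set.disjoint_iff_inter_eq_empty.2 hKs
  rw [Set.disjoint_union_right] at hKd
  obtain ⟨P, hP⟩ := exists_third a 𝓘 hbasis hne h2T I K L (himem hI) (himem hK) (himem hLA)
    hKd.1.symm hLs
  have hnd2 : ∀ S ∈ 𝓐, ¬ Dense (S ∪ K) := by
    intro S hS hd
    obtain ⟨T, hT, hTs⟩ := h𝓐sep S hS K hK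
    obtain ⟨t, ht⟩ := hne T (himem hT)
    have h2 := hd t
    rw [closure_union] at h2
    have : t ∈ closure T ∩ (closure S ∪ closure K) := ⟨subset_closure ht, h2⟩
    rw [hTs] at this
    exact this
  have hsub : ∀ S ∈ 𝓐, Disjoint (closure K) (closure S) → ∀ M ∈ 𝓘, M ⊆ S → Tup2 𝓘 M K := by
    intro S hS hd M hM hMS
    exact ⟨hM, himem hK, (hd.mono_right (closure_mono hMS)).symm,
      fun h => hnd2 S hS (h.mono (Set.union_subset_union_left K hMS))⟩
  obtain ⟨M, hM, hxM, hMs⟩ := hbasis.exists_subset_of_mem_open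
    (show x ∈ I ∩ a g ⁻¹' J from ⟨hxI, hxJ⟩)
    ((hbasis.isOpen (himem hI)).inter ((hbasis.isOpen (himem hJ)).preimage (hcont g)))
  have hTM := hsub I hI hKd.1 M hM (fun y hy => (hMs hy).1)
  have hTI := hsub I hI hKd.1 I (himem hI) subset_rfl
  have hTg := hsub J hJ hKd.2 (a g '' M) (h2T.1 g M hM)
    (by rintro _ ⟨y, hy, rfl⟩; exact (hMs hy).2)
  obtain ⟨c₀, hc₀, -⟩ := h2T.2 _ _ _ _ hTI hTM
  obtain ⟨c, hcI, hcK⟩ := extend_by_id a hact 𝓘 h2T hL I K P hP c₀ (by rw [hc₀]; exact hTM)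
  have hgc : a (g * c) '' I = a g '' M := by
    rw [← hc₀, Set.image_image]
    exact Set.image_congr fun y hy => by rw [hmul, hcI y hy]
  obtain ⟨d, hdI, hdK⟩ := extend_by_id a hact 𝓘 h2T hL I K P hP (g * c)
    (by rw [hgc]; exact hTg)
  refine ⟨[d, d⁻¹ * (g * c), c⁻¹], by simp, ?_, by simp [mul_assoc]⟩
  intro y hy
  simp only [List.mem_cons, List.not_mem_nil, or_false] at hy
  rcases hy with rfl | rfl | rfl
  · exact ⟨K, hK, hdK⟩
  · refine ⟨I, hI, fun z hz => ?_⟩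
    rw [hmul, ← hdI z hz, ← hmul, inv_mul_cancel, h1]
  · refine ⟨K, hK, fun z hz => ?_⟩
    conv_lhs => rw [← hcK z hz]
    rw [← hmul, inv_mul_cancel, h1]
end

section
/- Let X be a Cantor set and G a group acting faithfully on X by homeomorphisms. Suppose there exists a basis 𝓘 for the topology of X consisting of nonempty proper clopen subsets of X which is closed under complements (I ∈ 𝓘 implies X∖I ∈ 𝓘), is preserved by G (g·I ∈ 𝓘 for all g ∈ G, I ∈ 𝓘), and on which G acts transitively (for all I, I' ∈ 𝓘 there exists g ∈ G with g·I = I'). Then the action of G on X is extremely proximal: for every pair U, V of nonempty proper clopen subsets of X there exists f ∈ G with f·U ⊆ V. -/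
/-- `X` is a Cantor set: nonempty, compact, metrizable, totally disconnected,
without isolated points. -/
def IsCantorSet (X : Type*) [TopologicalSpace X] : Prop :=
  Nonempty X ∧ CompactSpace X ∧ TopologicalSpace.MetrizableSpace X ∧
    TotallyDisconnectedSpace X ∧ ∀ x : X, ¬ IsOpen ({x} : Set X)

/-- `G` (acting via `a`) is a topological full group: it contains every
homeomorphism which locally agrees with elements of `G`. -/
def IsTopologicalFullGroup (G : Type*) [Group G] (X : Type*)
    [TopologicalSpace X] (a : G → X → X) : Prop :=
  ∀ f : X ≃ₜ X,
    (∀ x : X, ∃ U : Set X, IsOpen U ∧ x ∈ U ∧ ∃ g : G, ∀ y ∈ U, f y = a g y) →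
    ∃ g : G, ∀ x : X, a g x = f x

/-- Under the transitivity hypotheses, the action of `G` on the Cantor set `X`
is extremely proximal. -/
theorem extremely_proximal {G X : Type*} [Group G] [TopologicalSpace X]
    (hX : IsCantorSet X)
    (a : G → X → X) (hact : IsActionByHomeos G X a)
    (hfaith : FaithfulAction G X a)
    (𝓘 : Set (Set X)) (hbasis : TopologicalSpace.IsTopologicalBasis 𝓘)
    (h𝓘 : ∀ I ∈ 𝓘, I.Nonempty ∧ I ≠ Set.univ ∧ IsClopen I)
    (hcompl : ∀ I ∈ 𝓘, Iᶜ ∈ 𝓘)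
    (hpres : ∀ g : G, ∀ I ∈ 𝓘, a g '' I ∈ 𝓘)
    (htrans : ∀ I ∈ 𝓘, ∀ I' ∈ 𝓘, ∃ g : G, a g '' I = I') :
    ∀ U V : Set X, IsClopen U → IsClopen V → U.Nonempty → V.Nonempty →
      U ≠ Set.univ → V ≠ Set.univ → ∃ f : G, a f '' U ⊆ V := by
  intro U V hU hV _ hVne hUne _
  obtain ⟨x, hx⟩ := (Set.ne_univ_iff_exists_notMem U).1 hUne
  obtain ⟨y, hy⟩ := hVne
  obtain ⟨J, hJ, _, hJU⟩ :=
    hbasis.exists_subset_of_mem_open (show x ∈ Uᶜ from hx) hU.compl.isOpen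
  obtain ⟨K, hK, _, hKV⟩ := hbasis.exists_subset_of_mem_open hy hV.isOpen
  obtain ⟨g, hg⟩ := htrans Jᶜ (hcompl J hJ) K hK
  refine ⟨g, fun z hz => hKV ?_⟩
  rw [← hg]
  exact Set.image_mono (Set.subset_compl_comm.1 hJU) hz
end

section
/- Let X be a Cantor set and G a group acting faithfully on X by homeomorphisms which is a topological full group. Suppose there exists a basis 𝓘 for the topology of X consisting of nonempty proper clopen subsets of X which is closed under complements (I ∈ 𝓘 implies X∖I ∈ 𝓘), is preserved by G (g·I ∈ 𝓘 for all g ∈ G, I ∈ 𝓘), and such that G acts transitively on 𝓘⁽⁴⁾. Then the commutator subgroup [G,G] acts transitively on 𝓘⁽³⁾: for all triples (I,J,K), (I',J',K') ∈ 𝓘⁽³⁾ there exists g ∈ [G,G] with g·I = I', g·J = J' and g·K = K'. -/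
/-- `(I, J, K, L) ∈ 𝓘⁽⁴⁾`: a quadruple of members of `𝓘` with pairwise
disjoint closures whose union is not dense. -/
def Tup4 {X : Type*} [TopologicalSpace X] (𝓘 : Set (Set X))
    (I J K L : Set X) : Prop :=
  I ∈ 𝓘 ∧ J ∈ 𝓘 ∧ K ∈ 𝓘 ∧ L ∈ 𝓘 ∧
    Disjoint (closure I) (closure J) ∧ Disjoint (closure I) (closure K) ∧
    Disjoint (closure I) (closure L) ∧ Disjoint (closure J) (closure K) ∧
    Disjoint (closure J) (closure L) ∧ Disjoint (closure K) (closure L) ∧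
    ¬ Dense (I ∪ J ∪ K ∪ L)


namespace CommTrans

lemma shrink {X : Type*} [TopologicalSpace X] [T2Space X] (hiso : ∀ x : X, ¬ IsOpen ({x} : Set X))
    (𝓘 : Set (Set X)) (hbasis : TopologicalSpace.IsTopologicalBasis 𝓘)
    (V : Set X) (hV : IsOpen V) (hne : V.Nonempty) :
    ∃ B ∈ 𝓘, B ⊆ V ∧ (V \ B).Nonempty := by
  obtain ⟨x, hx⟩ := hne
  have : ∃ y ∈ V, y ≠ x := by
    by_contra! h
    apply hiso x
    have : V = {x} := Set.eq_singleton_iff_unique_mem.2 ⟨hx, h⟩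
    rwa [← this]
  obtain ⟨y, hy, hyx⟩ := this
  obtain ⟨B, hB, hxB, hBV⟩ := hbasis.exists_subset_of_mem_open
    (show x ∈ V \ {y} from ⟨hx, fun h => hyx h.symm⟩) (hV.sdiff isClosed_singleton)
  exact ⟨B, hB, fun z hz => (hBV hz).1, y, hy, fun h => (hBV h).2 rfl⟩

lemma tup4_of {X : Type*} [TopologicalSpace X] (𝓘 : Set (Set X))
    (h𝓘 : ∀ I ∈ 𝓘, IsClopen I) {I J K L : Set X} (hI : I ∈ 𝓘) (hJ : J ∈ 𝓘) (hK : K ∈ 𝓘)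
    (hL : L ∈ 𝓘) (h1 : Disjoint I J) (h2 : Disjoint I K) (h3 : Disjoint J K)
    (hs : L ⊆ (I ∪ J ∪ K)ᶜ) (hn : ((I ∪ J ∪ K)ᶜ \ L).Nonempty) : Tup4 𝓘 I J K L := by
  have cI := (h𝓘 I hI).isClosed
  have cJ := (h𝓘 J hJ).isClosed
  have cK := (h𝓘 K hK).isClosed
  have cL := (h𝓘 L hL).isClosed
  unfold Tup4
  rw [cI.closure_eq, cJ.closure_eq, cK.closure_eq, cL.closure_eq]
  refine ⟨hI, hJ, hK, hL, h1, h2, ?_, h3, ?_, ?_, ?_⟩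
  · rw [Set.disjoint_left]; intro x hx hx'; exact hs hx' (Or.inl (Or.inl hx))
  · rw [Set.disjoint_left]; intro x hx hx'; exact hs hx' (Or.inl (Or.inr hx))
  · rw [Set.disjoint_left]; intro x hx hx'; exact hs hx' (Or.inr hx)
  · intro hd
    obtain ⟨x, hx, hxL⟩ := hn
    have h := hd x
    rw [(((cI.union cJ).union cK).union cL).closure_eq] at h
    rcases h with h | h
    · exact hx h
    · exact hxL h

lemma ext3 {X : Type*} [TopologicalSpace X] [T2Space X] (hiso : ∀ x : X, ¬ IsOpen ({x} : Set X))
    (𝓘 : Set (Set X)) (hbasis : TopologicalSpace.IsTopologicalBasis 𝓘)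
    (h𝓘 : ∀ I ∈ 𝓘, IsClopen I) {I J K : Set X} (hI : I ∈ 𝓘) (hJ : J ∈ 𝓘) (hK : K ∈ 𝓘)
    (h1 : Disjoint I J) (h2 : Disjoint I K) (h3 : Disjoint J K)
    (hn : (I ∪ J ∪ K)ᶜ.Nonempty) : ∃ L, Tup4 𝓘 I J K L := by
  obtain ⟨L, hL, hs, hn'⟩ := shrink hiso 𝓘 hbasis (I ∪ J ∪ K)ᶜ
    (((h𝓘 I hI).union (h𝓘 J hJ)).union (h𝓘 K hK)).compl.isOpen hn
  exact ⟨L, tup4_of 𝓘 h𝓘 hI hJ hK hL h1 h2 h3 hs hn'⟩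

lemma ext1 {X : Type*} [TopologicalSpace X] [T2Space X] (hiso : ∀ x : X, ¬ IsOpen ({x} : Set X))
    (𝓘 : Set (Set X)) (hbasis : TopologicalSpace.IsTopologicalBasis 𝓘)
    (h𝓘 : ∀ I ∈ 𝓘, IsClopen I) {I : Set X} (hI : I ∈ 𝓘)
    (hn : Iᶜ.Nonempty) : ∃ J K L, Tup4 𝓘 I J K L := by
  obtain ⟨J, hJ, hJs, hJn⟩ := shrink hiso 𝓘 hbasis Iᶜ (h𝓘 I hI).compl.isOpen hn
  obtain ⟨K, hK, hKs, hKn⟩ := shrink hiso 𝓘 hbasis (Iᶜ \ J)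
    ((h𝓘 I hI).compl.isOpen.sdiff (h𝓘 J hJ).isClosed) hJn
  refine ⟨J, K, ext3 hiso 𝓘 hbasis h𝓘 hI hJ hK ?_ ?_ ?_ ?_⟩
  · rw [Set.disjoint_left]; intro x hx hx'; exact hJs hx' hx
  · rw [Set.disjoint_left]; intro x hx hx'; exact (hKs hx').1 hx
  · rw [Set.disjoint_left]; intro x hx hx'; exact (hKs hx').2 hx
  · obtain ⟨x, ⟨h1, h2⟩, h3⟩ := hKn
    refine ⟨x, ?_⟩
    rintro ((h | h) | h)
    · exact h1 h
    · exact h2 h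
    · exact h3 h

lemma swap {G X : Type*} [Group G] [TopologicalSpace X]
    (a : G → X → X) (hact : IsActionByHomeos G X a) (hfull : IsTopologicalFullGroup G X a)
    (g : G) (U : Set X) (hU : IsClopen U) (hd : ∀ x ∈ U, a g x ∉ U) :
    ∃ t : G, (∀ x ∈ U, a t x = a g x) ∧ (∀ x ∈ U, a t (a g x) = x) ∧
      ∀ x, x ∉ U → a g⁻¹ x ∉ U → a t x = x := by
  classical
  obtain ⟨h1, hmul, hcont⟩ := hact
  have hinv : ∀ x, a g⁻¹ (a g x) = x := fun x => by rw [← hmul]; simp [h1]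
  have hinv' : ∀ x, a g (a g⁻¹ x) = x := fun x => by rw [← hmul]; simp [h1]
  let f : X → X := fun x => if x ∈ U then a g x else if a g⁻¹ x ∈ U then a g⁻¹ x else x
  have f1 : ∀ x, x ∈ U → f x = a g x := fun x hx => by simp [f, hx]
  have f2 : ∀ x, x ∉ U → a g⁻¹ x ∈ U → f x = a g⁻¹ x := fun x hx hx' => by simp [f, hx, hx']
  have f3 : ∀ x, x ∉ U → a g⁻¹ x ∉ U → f x = x := fun x hx hx' => by simp [f, hx, hx']
  have f4 : ∀ x, x ∈ U → f (a g x) = x := fun x hx => by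
    rw [f2 _ (hd x hx) (by rwa [hinv]), hinv]
  have hW : IsClopen {x | a g⁻¹ x ∈ U} := hU.preimage (hcont g⁻¹)
  have ff : ∀ x, f (f x) = x := by
    intro x
    by_cases hx : x ∈ U
    · rw [f1 x hx, f4 x hx]
    · by_cases hx' : a g⁻¹ x ∈ U
      · rw [f2 x hx hx', f1 _ hx', hinv']
      · rw [f3 x hx hx', f3 x hx hx']
  have hloc : ∀ x : X, ∃ U : Set X, IsOpen U ∧ x ∈ U ∧ ∃ g : G, ∀ y ∈ U, f y = a g y := by
    intro x
    by_cases hx : x ∈ U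
    · exact ⟨U, hU.isOpen, hx, g, f1⟩
    · by_cases hx' : a g⁻¹ x ∈ U
      · exact ⟨Uᶜ ∩ {x | a g⁻¹ x ∈ U}, hU.compl.isOpen.inter hW.isOpen, ⟨hx, hx'⟩, g⁻¹,
          fun y hy => f2 y hy.1 hy.2⟩
      · exact ⟨Uᶜ ∩ {x | a g⁻¹ x ∈ U}ᶜ, hU.compl.isOpen.inter hW.compl.isOpen, ⟨hx, hx'⟩, 1,
          fun y hy => by rw [f3 y hy.1 hy.2, h1]⟩
  have hfc : Continuous f := by
    rw [continuous_iff_continuousAt]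
    intro x
    obtain ⟨V, hV, hxV, k, hk⟩ := hloc x
    refine (hcont k).continuousAt.congr ?_
    filter_upwards [hV.mem_nhds hxV] with y hy
    exact (hk y hy).symm
  let F : X ≃ₜ X :=
    { toFun := f, invFun := f, left_inv := ff, right_inv := ff,
      continuous_toFun := hfc, continuous_invFun := hfc }
  obtain ⟨t, ht⟩ := hfull F hloc
  have ht : ∀ x, a t x = f x := ht
  exact ⟨t, fun x hx => by rw [ht, f1 x hx], fun x hx => by rw [ht, f4 x hx],
    fun x hx hx' => by rw [ht, f3 x hx hx']⟩

end CommTrans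

/-- If the topological full group `G` acts transitively on `𝓘⁽⁴⁾`, then its
commutator subgroup acts transitively on `𝓘⁽³⁾`. -/
theorem commutator_transitive_on_triples {G X : Type*} [Group G]
    [TopologicalSpace X] (hX : IsCantorSet X)
    (a : G → X → X) (hact : IsActionByHomeos G X a)
    (hfaith : FaithfulAction G X a)
    (hfull : IsTopologicalFullGroup G X a)
    (𝓘 : Set (Set X)) (hbasis : TopologicalSpace.IsTopologicalBasis 𝓘)
    (h𝓘 : ∀ I ∈ 𝓘, I.Nonempty ∧ I ≠ Set.univ ∧ IsClopen I)
    (hcompl : ∀ I ∈ 𝓘, Iᶜ ∈ 𝓘)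
    (hpres : ∀ g : G, ∀ I ∈ 𝓘, a g '' I ∈ 𝓘)
    (htrans4 : ∀ I J K L I' J' K' L' : Set X, Tup4 𝓘 I J K L →
      Tup4 𝓘 I' J' K' L' → ∃ g : G,
        a g '' I = I' ∧ a g '' J = J' ∧ a g '' K = K' ∧ a g '' L = L') :
    ∀ I J K I' J' K' : Set X, Tup3 𝓘 I J K → Tup3 𝓘 I' J' K' →
      ∃ g ∈ commutator G, a g '' I = I' ∧ a g '' J = J' ∧ a g '' K = K' := by
  obtain ⟨-, -, hmet, -, hiso⟩ := hX
  have hT2 : T2Space X := inferInstance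
  have hact' := hact
  obtain ⟨h1, hmul, hcont⟩ := hact'
  have hinv : ∀ g x, a g⁻¹ (a g x) = x := fun g x => by rw [← hmul]; simp [h1]
  have hinv' : ∀ g x, a g (a g⁻¹ x) = x := fun g x => by rw [← hmul]; simp [h1]
  have hclop : ∀ I ∈ 𝓘, IsClopen I := fun I hI => (h𝓘 I hI).2.2
  have hcn : ∀ I ∈ 𝓘, Iᶜ.Nonempty := fun I hI =>
    Set.nonempty_compl.2 (h𝓘 I hI).2.1
  -- moving supports into a small set
  have hconj : ∀ V : Set X, IsOpen V → V.Nonempty → ∀ A ∈ 𝓘, ∀ g : G,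
      (∀ x, x ∉ A → a g x = x) → ∃ h : G, (∀ x, x ∉ V → a h x = x) ∧
        Abelianization.of h = Abelianization.of g := by
    intro V hV hVn A hA g hg
    obtain ⟨B, hB, hBV, -⟩ := CommTrans.shrink hiso 𝓘 hbasis V hV hVn
    obtain ⟨_, _, _, hA4⟩ := CommTrans.ext1 hiso 𝓘 hbasis hclop hA (hcn A hA)
    obtain ⟨_, _, _, hB4⟩ := CommTrans.ext1 hiso 𝓘 hbasis hclop hB (hcn B hB)
    obtain ⟨k, hk, -⟩ := htrans4 _ _ _ _ _ _ _ _ hA4 hB4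
    refine ⟨k * g * k⁻¹, ?_, ?_⟩
    · intro x hx
      rw [hmul, hmul, hg, hinv']
      intro hxA
      apply hx
      apply hBV
      rw [← hk]
      exact ⟨_, hxA, hinv' k x⟩
    · rw [map_mul, map_mul, map_inv, mul_comm, inv_mul_cancel_left]
  have hfrag : ∀ V : Set X, IsOpen V → V.Nonempty → ∀ g : G,
      ∃ h : G, (∀ x, x ∉ V → a h x = x) ∧ Abelianization.of h = Abelianization.of g := by
    intro V hV hVn g
    by_cases hg : ∀ x, a g x = x
    · exact ⟨1, fun x _ => h1 x, by rw [hfaith g hg]⟩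
    push Not at hg
    obtain ⟨x, hx⟩ := hg
    have : ∃ y, y ≠ x ∧ y ≠ a g x := by
      by_contra! h
      apply hiso x
      have : ({x} : Set X) = {a g x}ᶜ := by
        ext z
        simp only [Set.mem_singleton_iff, Set.mem_compl_iff]
        constructor
        · rintro rfl h'
          exact hx h'.symm
        · intro hz
          by_contra hzx
          exact hz (h z hzx)
      rw [this]
      exact isClosed_singleton.isOpen_compl
    obtain ⟨y, hyx, hyg⟩ := this
    obtain ⟨P, Q, hP, hQ, hxP, hgQ, hPQ⟩ := t2_separation (Ne.symm hx)
    obtain ⟨B, hB, hyB, hBs⟩ := hbasis.exists_subset_of_mem_open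
      (show y ∈ ({x}ᶜ ∩ {a g x}ᶜ : Set X) from ⟨hyx, hyg⟩)
      (isClosed_singleton.isOpen_compl.inter isClosed_singleton.isOpen_compl)
    have hBo := (hclop B hB).compl.isOpen
    obtain ⟨U, hU, hxU, hUs⟩ := hbasis.exists_subset_of_mem_open
      (show x ∈ (P ∩ Bᶜ) ∩ a g ⁻¹' (Q ∩ Bᶜ) from
        ⟨⟨hxP, fun h => (hBs h).1 rfl⟩, hgQ, fun h => (hBs h).2 rfl⟩)
      ((hP.inter hBo).inter ((hQ.inter hBo).preimage (hcont g)))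
    obtain ⟨t, ht1, ht2, ht3⟩ := CommTrans.swap a hact hfull g U (hclop U hU)
      (fun z hz hz' => Set.disjoint_left.1 hPQ (hUs hz').1.1 (hUs hz).2.1)
    obtain ⟨p, hp, hp'⟩ := hconj V hV hVn Bᶜ (hcompl B hB) t (by
      intro z hz
      apply ht3 z
      · exact fun h => hz (hUs h).1.2
      · intro h
        have := (hUs h).2.2
        rw [hinv'] at this
        exact hz this)
    obtain ⟨q, hq, hq'⟩ := hconj V hV hVn Uᶜ (hcompl U hU) (t⁻¹ * g) (by
      intro z hz
      have hz : z ∈ U := not_not.1 hz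
      rw [hmul, ← ht1 z hz, hinv])
    refine ⟨p * q, ?_, ?_⟩
    · intro z hz
      rw [hmul, hq z hz, hp z hz]
    · rw [map_mul, hp', hq', ← map_mul, mul_inv_cancel_left]
  intro I J K I' J' K' hT hT'
  have key : ∀ I J K : Set X, Tup3 𝓘 I J K → (I ∪ J ∪ K)ᶜ.Nonempty ∧ ∃ L, Tup4 𝓘 I J K L := by
    rintro I J K ⟨hI, hJ, hK, d1, d2, d3, hn⟩
    have hn' : (I ∪ J ∪ K)ᶜ.Nonempty := by
      rw [Set.nonempty_compl]
      intro h
      rw [h] at hn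
      exact hn dense_univ
    exact ⟨hn', CommTrans.ext3 hiso 𝓘 hbasis hclop hI hJ hK
      (d1.mono subset_closure subset_closure) (d2.mono subset_closure subset_closure)
      (d3.mono subset_closure subset_closure) hn'⟩
  obtain ⟨hn, L, hL⟩ := key I J K hT
  obtain ⟨-, L', hL'⟩ := key I' J' K' hT'
  obtain ⟨g, gI, gJ, gK, -⟩ := htrans4 _ _ _ _ _ _ _ _ hL hL'
  obtain ⟨h, hh, hab⟩ := hfrag (I ∪ J ∪ K)ᶜ
    (((hclop I hT.1).union (hclop J hT.2.1)).union (hclop K hT.2.2.1)).compl.isOpen hn g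
  have hh' : ∀ x ∈ I ∪ J ∪ K, a (g * h⁻¹) x = a g x := by
    intro x hx
    have h2 := hh x (fun h => h hx)
    rw [hmul]
    congr 1
    conv_lhs => rw [← h2]
    exact hinv h x
  refine ⟨g * h⁻¹, ?_, ?_, ?_, ?_⟩
  · rw [← Abelianization.ker_of, MonoidHom.mem_ker, map_mul, map_inv, hab, mul_inv_cancel]
  · rw [← gI]; exact Set.image_congr fun x hx => hh' x (Or.inl (Or.inl hx))
  · rw [← gJ]; exact Set.image_congr fun x hx => hh' x (Or.inl (Or.inr hx))
  · rw [← gK]; exact Set.image_congr fun x hx => hh' x (Or.inr hx)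
end
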